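/- arXiv:2105.03738 — 11 statements merged into one kernel-verified Lean document; each statement's English description precedes it below -/
import Mathlib

section
/- Let M ∈ ℂ^{N×N} be Hermitian positive definite, let A ∈ ℂ^{p×N} be a selection matrix (1 ≤ p ≤ N), and let y ∈ ℂ^p. Then −ln det(A M A†) − y† (A M A†)^{−1} y ≤ −p · ln λ_min(M) − ‖y‖² / tr(M), where λ_min(M) denotes the smallest eigenvalue of M and ‖y‖ the Euclidean norm. -/
open Matrix
open scoped ComplexOrder

noncomputable section

/-- `A` is a selection matrix: its rows are `p` distinct rows of the `N × N` identity matrix. -/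
def IsSelection {p N : ℕ} (A : Matrix (Fin p) (Fin N) ℂ) : Prop :=
  ∃ f : Fin p → Fin N, Function.Injective f ∧ ∀ i j, A i j = if j = f i then 1 else 0

theorem spec_aux {n : ℕ} (B : Matrix (Fin n) (Fin n) ℂ) (hB : B.IsHermitian) :
    ∃ U : Matrix (Fin n) (Fin n) ℂ, U * Uᴴ = 1 ∧ Uᴴ * U = 1 ∧
      B = U * diagonal (fun i => (hB.eigenvalues i : ℂ)) * Uᴴ := by
  refine ⟨hB.eigenvectorUnitary, ?_, ?_, ?_⟩
  · exact (Matrix.mem_unitaryGroup_iff).1 hB.eigenvectorUnitary.2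
  · exact (Matrix.mem_unitaryGroup_iff').1 hB.eigenvectorUnitary.2
  · have := hB.spectral_theorem
    rw [Unitary.conjStarAlgAut_apply] at this
    exact this

theorem psd_sub_aux {n : ℕ} (B : Matrix (Fin n) (Fin n) ℂ) (hB : B.IsHermitian) (l : ℝ) :
    (B - (l : ℂ) • (1 : Matrix (Fin n) (Fin n) ℂ)).PosSemidef ↔ ∀ i, l ≤ hB.eigenvalues i := by
  obtain ⟨U, h1, h2, h3⟩ := spec_aux B hB
  have e : diagonal (fun i => ((hB.eigenvalues i : ℂ) - (l : ℂ)))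
      = diagonal (fun i => (hB.eigenvalues i : ℂ)) - (l : ℂ) • (1 : Matrix (Fin n) (Fin n) ℂ) := by
    rw [smul_one_eq_diagonal, diagonal_sub]
  have key : B - (l : ℂ) • (1 : Matrix (Fin n) (Fin n) ℂ)
      = U * diagonal (fun i => ((hB.eigenvalues i : ℂ) - (l : ℂ))) * Uᴴ := by
    rw [e, mul_sub, sub_mul, ← h3]
    simp [h1]
  have hd : (diagonal (fun i => ((hB.eigenvalues i : ℂ) - (l : ℂ)))).PosSemidef ↔
      ∀ i, l ≤ hB.eigenvalues i := by
    rw [posSemidef_diagonal_iff]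
    refine forall_congr' fun i => ?_
    rw [← Complex.ofReal_sub, Complex.zero_le_real, sub_nonneg]
  rw [← hd, key]
  constructor
  · intro h
    have h' := h.conjTranspose_mul_mul_same U
    have e2 : Uᴴ * (U * diagonal (fun i => ((hB.eigenvalues i : ℂ) - (l : ℂ))) * Uᴴ) * U
        = (Uᴴ * U) * diagonal (fun i => ((hB.eigenvalues i : ℂ) - (l : ℂ))) * (Uᴴ * U) := by
      simp only [mul_assoc]
    rw [e2, h2, one_mul, mul_one] at h'
    exact h'
  · intro h
    exact h.mul_mul_conjTranspose_same U

theorem inv_aux {n : ℕ} (B : Matrix (Fin n) (Fin n) ℂ) (hB : B.PosDef) (t : ℝ)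
    (ht : ∀ i, hB.1.eigenvalues i ≤ t) :
    (B⁻¹ - ((t⁻¹ : ℝ) : ℂ) • (1 : Matrix (Fin n) (Fin n) ℂ)).PosSemidef := by
  obtain ⟨U, h1, h2, h3⟩ := spec_aux B hB.1
  have hinv : B⁻¹ = U * diagonal (fun i => ((hB.1.eigenvalues i : ℂ))⁻¹) * Uᴴ := by
    apply Matrix.inv_eq_right_inv
    have hdd : diagonal (fun i => (hB.1.eigenvalues i : ℂ)) *
        diagonal (fun i => ((hB.1.eigenvalues i : ℂ))⁻¹) = 1 := by
      rw [diagonal_mul_diagonal, ← diagonal_one]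
      congr 1
      funext i
      exact mul_inv_cancel₀ (by exact_mod_cast (hB.eigenvalues_pos i).ne')
    calc B * (U * diagonal (fun i => ((hB.1.eigenvalues i : ℂ))⁻¹) * Uᴴ)
        = U * (diagonal (fun i => (hB.1.eigenvalues i : ℂ)) * (Uᴴ * U) *
          diagonal (fun i => ((hB.1.eigenvalues i : ℂ))⁻¹)) * Uᴴ := by
          refine (congrArg (· * (U * diagonal (fun i => ((hB.1.eigenvalues i : ℂ))⁻¹) * Uᴴ))
            h3).trans ?_
          simp only [mul_assoc]
      _ = 1 := by rw [h2, mul_one, hdd, mul_one, h1]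
  have e : diagonal (fun i => (((hB.1.eigenvalues i : ℂ))⁻¹ - ((t⁻¹ : ℝ) : ℂ)))
      = diagonal (fun i => ((hB.1.eigenvalues i : ℂ))⁻¹)
        - ((t⁻¹ : ℝ) : ℂ) • (1 : Matrix (Fin n) (Fin n) ℂ) := by
    rw [smul_one_eq_diagonal, diagonal_sub]
  have key : B⁻¹ - ((t⁻¹ : ℝ) : ℂ) • (1 : Matrix (Fin n) (Fin n) ℂ)
      = U * diagonal (fun i => (((hB.1.eigenvalues i : ℂ))⁻¹ - ((t⁻¹ : ℝ) : ℂ))) * Uᴴ := by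
    rw [e, mul_sub, sub_mul, ← hinv, Matrix.mul_smul, mul_one, Matrix.smul_mul, h1]
  rw [key]
  refine PosSemidef.mul_mul_conjTranspose_same ?_ U
  rw [posSemidef_diagonal_iff]
  intro i
  rw [← Complex.ofReal_inv, ← Complex.ofReal_sub, Complex.zero_le_real, sub_nonneg]
  exact inv_anti₀ (hB.eigenvalues_pos i) (ht i)

/-- for a Hermitian positive definite `M`, a selection matrix `A` (with
`1 ≤ p ≤ N`) and `y ∈ ℂ^p`,
`−ln det(A M A†) − y† (A M A†)⁻¹ y ≤ −p · ln λ_min(M) − ‖y‖² / tr(M)`. -/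
theorem stmt2 {p N : ℕ} (hp : 1 ≤ p) (hpN : p ≤ N)
    (M : Matrix (Fin N) (Fin N) ℂ) (hM : M.PosDef)
    (A : Matrix (Fin p) (Fin N) ℂ) (hA : IsSelection A) (y : Fin p → ℂ) :
    -Real.log ((A * M * Aᴴ).det.re)
      - (star y ⬝ᵥ ((A * M * Aᴴ)⁻¹ *ᵥ y)).re
    ≤ -(p : ℝ) * Real.log (⨅ j : Fin N, hM.1.eigenvalues j)
      - (∑ i, ‖y i‖ ^ 2) / M.trace.re := by
  obtain ⟨f, hf, hAf⟩ := hA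
  have hB : A * M * Aᴴ = M.submatrix f f := by
    ext i j
    simp [Matrix.mul_apply, hAf, Matrix.conjTranspose_apply, apply_ite]
  rw [hB]
  have hBP : (M.submatrix f f).PosDef := hM.submatrix hf
  generalize hBd : M.submatrix f f = B at *
  haveI : Nonempty (Fin N) := ⟨⟨0, by omega⟩⟩
  set l := ⨅ j : Fin N, hM.1.eigenvalues j with hl
  have hl0 : 0 < l := by
    obtain ⟨j, hj⟩ := exists_eq_ciInf_of_finite (f := hM.1.eigenvalues)
    rw [hl, ← hj]
    exact hM.eigenvalues_pos j
  have hle : ∀ i, l ≤ hBP.1.eigenvalues i := by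
    rw [← psd_sub_aux B hBP.1]
    have h1 := ((psd_sub_aux M hM.1 l).2
      (fun i => ciInf_le (Set.finite_range _).bddBelow i)).submatrix f
    convert h1 using 1
    rw [← hBd]
    ext i j
    simp [Matrix.one_apply, hf.eq_iff]
  have hdet : B.det.re = ∏ i, hBP.1.eigenvalues i := by
    rw [hBP.1.det_eq_prod_eigenvalues]
    simp only [Complex.coe_algebraMap, ← Complex.ofReal_prod, Complex.ofReal_re,
      RCLike.ofReal_eq_complex_ofReal]
  have hlog : (p : ℝ) * Real.log l ≤ Real.log B.det.re := by
    rw [hdet, ← Real.log_pow]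
    apply Real.log_le_log (by positivity)
    calc l ^ p = ∏ i : Fin p, l := by simp
      _ ≤ _ := Finset.prod_le_prod (fun _ _ => hl0.le) (fun i _ => hle i)
  have htrB : B.trace.re = ∑ i, hBP.1.eigenvalues i := by
    rw [hBP.1.trace_eq_sum_eigenvalues]
    simp
  have htr : B.trace.re ≤ M.trace.re := by
    rw [← hBd]
    simp only [Matrix.trace, Matrix.diag_apply, Matrix.submatrix_apply, Complex.re_sum]
    rw [← Finset.sum_image (s := Finset.univ) (g := f) (f := fun j => (M j j).re)
      (fun a _ b _ h => hf h)]
    apply Finset.sum_le_sum_of_subset_of_nonneg (Finset.subset_univ _)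
    intro j _ _
    exact (Complex.le_def.1 (hM.posSemidef.diag_nonneg (i := j))).1
  have ht : ∀ i, hBP.1.eigenvalues i ≤ M.trace.re := fun i => by
    refine le_trans ?_ htr
    rw [htrB]
    exact Finset.single_le_sum (f := hBP.1.eigenvalues)
      (fun j _ => (hBP.eigenvalues_pos j).le) (Finset.mem_univ i)
  have hq := (Complex.le_def.1 ((inv_aux B hBP _ ht).dotProduct_mulVec_nonneg y)).1
  have hy : star y ⬝ᵥ y = ((∑ i, ‖y i‖ ^ 2 : ℝ) : ℂ) := by
    simp [dotProduct, Complex.conj_mul']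
  rw [sub_mulVec, dotProduct_sub, smul_mulVec, one_mulVec, dotProduct_smul, hy, smul_eq_mul,
    ← Complex.ofReal_mul, Complex.sub_re, Complex.ofReal_re, Complex.zero_re] at hq
  rw [div_eq_inv_mul]
  linarith
end
end

section
/- In the missing-data model, let δ > 0 and let M ∈ ℂ^{N×N} be Hermitian with λ_min(M) ≥ δ (so M is positive definite). Then L_y(M) ≤ −(∑_{i=1}^K p_i) ln π − (∑_{i=1}^K p_i) ln δ − (∑_{i=1}^K ‖y_i‖²) / tr(M). -/
open Matrix
open scoped ComplexOrder

noncomputable section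

/-- Observed-data log-likelihood
`L_y(M) = −∑_{i=1}^K [ p_i ln π + ln det(A_i M A_i†) + y_i† (A_i M A_i†)⁻¹ y_i ]`. -/
def obsLogLik {N K : ℕ} (p : Fin K → ℕ) (A : ∀ i, Matrix (Fin (p i)) (Fin N) ℂ)
    (y : ∀ i, Fin (p i) → ℂ) (M : Matrix (Fin N) (Fin N) ℂ) : ℝ :=
  -∑ i, ((p i : ℝ) * Real.log Real.pi
      + Real.log ((A i * M * (A i)ᴴ).det.re)
      + (star (y i) ⬝ᵥ ((A i * M * (A i)ᴴ)⁻¹ *ᵥ y i)).re)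

theorem psd_lin_iff {n : ℕ} {M : Matrix (Fin n) (Fin n) ℂ} (hM : M.IsHermitian) (a b : ℝ) :
    ((a : ℂ) • M + (b : ℂ) • (1 : Matrix (Fin n) (Fin n) ℂ)).PosSemidef ↔
      ∀ i, 0 ≤ a * hM.eigenvalues i + b := by
  have h : (a : ℂ) • M + (b : ℂ) • (1 : Matrix (Fin n) (Fin n) ℂ) =
      (hM.eigenvectorUnitary : Matrix (Fin n) (Fin n) ℂ) *
        diagonal (fun i => ((a * hM.eigenvalues i + b : ℝ) : ℂ)) *
        star (hM.eigenvectorUnitary : Matrix (Fin n) (Fin n) ℂ) := by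
    have h1 : diagonal (fun i => ((a * hM.eigenvalues i + b : ℝ) : ℂ)) =
        (a : ℂ) • diagonal (RCLike.ofReal ∘ hM.eigenvalues)
          + (b : ℂ) • (1 : Matrix (Fin n) (Fin n) ℂ) := by
      ext i j
      by_cases hij : i = j
      · subst hij; simp
      · simp [hij]
    have h2 := hM.spectral_theorem
    rw [Unitary.conjStarAlgAut_apply] at h2
    rw [h1, mul_add, add_mul, mul_smul_comm, smul_mul_assoc, ← h2, mul_smul_comm, mul_one,
      smul_mul_assoc, Unitary.mul_star_self_of_mem hM.eigenvectorUnitary.2]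
  rw [h, IsUnit.posSemidef_star_right_conjugate_iff Unitary.isUnit_coe, posSemidef_diagonal_iff]
  exact forall_congr' fun i => by rw [Complex.zero_le_real]

theorem quad_inv {n : ℕ} {B : Matrix (Fin n) (Fin n) ℂ} (hB : B.PosDef) (t : ℝ) (ht : 0 < t)
    (hBt : (((-1 : ℝ) : ℂ) • B + (t : ℂ) • (1 : Matrix (Fin n) (Fin n) ℂ)).PosSemidef)
    (y : Fin n → ℂ) :
    (∑ j, ‖y j‖ ^ 2) / t ≤ (star y ⬝ᵥ (B⁻¹ *ᵥ y)).re := by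
  set C := ((-1 : ℝ) : ℂ) • B + (t : ℂ) • (1 : Matrix (Fin n) (Fin n) ℂ) with hC
  have hdet : IsUnit B.det := (Matrix.isUnit_iff_isUnit_det _).1 hB.isUnit
  have h1 := (hB.inv.posSemidef.conjTranspose_mul_mul_same C).re_dotProduct_nonneg y
  have h2 := hBt.re_dotProduct_nonneg y
  have h3 : Cᴴ * B⁻¹ * C = ((t ^ 2 : ℝ) : ℂ) • B⁻¹ - (t : ℂ) • (1 : Matrix (Fin n) (Fin n) ℂ)
      - C := by
    rw [hBt.1.eq, hC]
    simp only [add_mul, mul_add, smul_mul_assoc, mul_smul_comm, one_mul, mul_one,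
      Matrix.mul_nonsing_inv _ hdet, Matrix.nonsing_inv_mul _ hdet]
    push_cast
    module
  have hy : (star y ⬝ᵥ y).re = ∑ j, ‖y j‖ ^ 2 := by
    simp only [dotProduct, Complex.re_sum]
    refine Finset.sum_congr rfl fun j _ => ?_
    rw [← Complex.normSq_eq_norm_sq, Complex.normSq_apply]
    simp [Complex.mul_re]
  rw [h3] at h1
  simp only [sub_mulVec, smul_mulVec, one_mulVec, dotProduct_sub, dotProduct_smul, smul_eq_mul,
    RCLike.re_eq_complex_re, Complex.sub_re, Complex.re_ofReal_mul, hy] at h1 h2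
  rw [div_le_iff₀ ht]
  have : 0 ≤ t * ((star y ⬝ᵥ (B⁻¹ *ᵥ y)).re * t - ∑ j, ‖y j‖ ^ 2) := by nlinarith
  exact sub_nonneg.1 (nonneg_of_mul_nonneg_right this ht)

theorem log_det_ge {n : ℕ} {B : Matrix (Fin n) (Fin n) ℂ} (hB : B.IsHermitian) (δ : ℝ) (hδ : 0 < δ)
    (h : ∀ i, δ ≤ hB.eigenvalues i) : n * Real.log δ ≤ Real.log B.det.re := by
  rw [hB.det_eq_prod_eigenvalues, ← Real.log_pow]
  have : (∏ i, ((hB.eigenvalues i : ℝ) : ℂ)).re = ∏ i, hB.eigenvalues i := by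
    rw [← Complex.ofReal_prod, Complex.ofReal_re]
  refine Real.log_le_log (by positivity) ?_
  refine le_trans ?_ this.ge
  calc δ ^ n = ∏ _i : Fin n, δ := by simp
    _ ≤ _ := Finset.prod_le_prod (fun _ _ => hδ.le) (fun i _ => h i)

theorem sel_eq {p N : ℕ} {A : Matrix (Fin p) (Fin N) ℂ} {f : Fin p → Fin N}
    (hf : ∀ i j, A i j = if j = f i then 1 else 0) (M : Matrix (Fin N) (Fin N) ℂ) :
    A * M * Aᴴ = M.submatrix f f := by
  ext i j
  simp [Matrix.mul_apply, hf, apply_ite]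

theorem lin_sub {p N : ℕ} {f : Fin p → Fin N} (hf : Function.Injective f)
    (M : Matrix (Fin N) (Fin N) ℂ) (a b : ℂ) :
    (a • M + b • (1 : Matrix (Fin N) (Fin N) ℂ)).submatrix f f =
      a • M.submatrix f f + b • (1 : Matrix (Fin p) (Fin p) ℂ) := by
  ext i j
  simp [Matrix.one_apply, hf.eq_iff]

/-- in the missing-data model, if `M` is Hermitian with `λ_min(M) ≥ δ > 0`, then
`L_y(M) ≤ −(∑ p_i) ln π − (∑ p_i) ln δ − (∑ ‖y_i‖²) / tr(M)`. -/
theorem stmt3 {N K : ℕ} (hN : 0 < N) (hK : 0 < K)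
    (p : Fin K → ℕ) (hp : ∀ i, 1 ≤ p i ∧ p i ≤ N)
    (A : ∀ i, Matrix (Fin (p i)) (Fin N) ℂ) (hA : ∀ i, IsSelection (A i))
    (y : ∀ i, Fin (p i) → ℂ)
    (δ : ℝ) (hδ : 0 < δ)
    (M : Matrix (Fin N) (Fin N) ℂ) (hM : M.IsHermitian)
    (hmin : δ ≤ ⨅ j : Fin N, hM.eigenvalues j) :
    obsLogLik p A y M
      ≤ -(∑ i, (p i : ℝ)) * Real.log Real.pi
        - (∑ i, (p i : ℝ)) * Real.log δ
        - (∑ i, ∑ j, ‖y i j‖ ^ 2) / M.trace.re := by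
  have hev : ∀ j, δ ≤ hM.eigenvalues j := fun j =>
    hmin.trans (ciInf_le (Set.finite_range _).bddBelow j)
  have hpos : M.PosDef := hM.posDef_iff_eigenvalues_pos.2 fun j => hδ.trans_le (hev j)
  have htr : M.trace.re = ∑ j, hM.eigenvalues j := by
    rw [hM.trace_eq_sum_eigenvalues]
    simp
  have hle : ∀ j, hM.eigenvalues j ≤ M.trace.re := fun j => by
    rw [htr]
    exact Finset.single_le_sum (f := hM.eigenvalues)
      (fun k _ => (hδ.trans_le (hev k)).le) (Finset.mem_univ j)
  have ht : 0 < M.trace.re := (hδ.trans_le (hev ⟨0, hN⟩)).trans_le (hle _)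
  have key : ∀ i, (p i : ℝ) * Real.log Real.pi + (p i : ℝ) * Real.log δ
      + (∑ j, ‖y i j‖ ^ 2) / M.trace.re ≤ (p i : ℝ) * Real.log Real.pi
      + Real.log ((A i * M * (A i)ᴴ).det.re)
      + (star (y i) ⬝ᵥ ((A i * M * (A i)ᴴ)⁻¹ *ᵥ y i)).re := by
    intro i
    obtain ⟨f, hf, hAf⟩ := hA i
    rw [sel_eq hAf]
    have hB : (M.submatrix f f).PosDef := hpos.submatrix hf
    have e1 := ((psd_lin_iff hM 1 (-δ)).2 fun j => by linarith [hev j]).submatrix f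
    have e2 := ((psd_lin_iff hM (-1) M.trace.re).2 fun j => by linarith [hle j]).submatrix f
    rw [lin_sub hf] at e1 e2
    rw [psd_lin_iff hB.1] at e1
    have l1 := log_det_ge hB.1 δ hδ fun j => by linarith [e1 j]
    have l2 := quad_inv hB _ ht e2 (y i)
    linarith
  have hs := Finset.sum_le_sum fun i (_ : i ∈ Finset.univ) => key i
  unfold obsLogLik
  rw [Finset.sum_add_distrib, Finset.sum_add_distrib, ← Finset.sum_mul, ← Finset.sum_mul,
    ← Finset.sum_div] at hs
  linarith
end
end

section
/- Let Σ ∈ ℂ^{N×N} be Hermitian positive definite. For every c ∈ ℝ there exist constants a > 0 and b > 0 such that every Hermitian positive definite M ∈ ℂ^{N×N} with g_Σ(M) ≥ c satisfies λ_min(M) ≥ a and tr(M) ≤ b. In particular, the superlevel sets of g_Σ on the positive definite matrices are bounded and bounded away from the boundary of the positive definite cone. -/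
open Matrix
open scoped ComplexOrder

noncomputable section

/-- `g_Σ(M) = −ln det M − tr(M⁻¹ Σ)` for Hermitian positive definite matrices over ℂ
(real-valued since both terms are real in that case). -/
def gFun {N : ℕ} (S M : Matrix (Fin N) (Fin N) ℂ) : ℝ :=
  -Real.log (M.det.re) - ((M⁻¹ * S).trace).re

theorem aux_spec {N : ℕ} (M : Matrix (Fin N) (Fin N) ℂ) (hM : M.IsHermitian) :
    ∃ U : Matrix (Fin N) (Fin N) ℂ, Uᴴ * U = 1 ∧ U * Uᴴ = 1 ∧
      M = U * diagonal (fun i => (hM.eigenvalues i : ℂ)) * Uᴴ := by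
  refine ⟨hM.eigenvectorUnitary, ?_, ?_, ?_⟩
  · exact Unitary.coe_star_mul_self hM.eigenvectorUnitary
  · exact Unitary.coe_mul_star_self hM.eigenvectorUnitary
  · have h := hM.spectral_theorem
    rw [Unitary.conjStarAlgAut_apply] at h
    exact h

theorem aux_lower {N : ℕ} (S : Matrix (Fin N) (Fin N) ℂ) (hS : S.PosDef) :
    ∃ s : ℝ, 0 < s ∧ (S - (s : ℂ) • (1 : Matrix (Fin N) (Fin N) ℂ)).PosSemidef := by
  obtain ⟨U, h1, h2, h3⟩ := aux_spec S hS.1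
  obtain ⟨s, hs, hle⟩ : ∃ s : ℝ, 0 < s ∧ ∀ i, s ≤ hS.1.eigenvalues i := by
    rcases isEmpty_or_nonempty (Fin N) with h | h
    · exact ⟨1, one_pos, fun i => h.elim i⟩
    · obtain ⟨i, hi⟩ := Finite.exists_min hS.1.eigenvalues
      exact ⟨_, hS.eigenvalues_pos i, hi⟩
  refine ⟨s, hs, ?_⟩
  have : S - (s : ℂ) • (1 : Matrix (Fin N) (Fin N) ℂ)
      = U * diagonal (fun i => ((hS.1.eigenvalues i - s : ℝ) : ℂ)) * Uᴴ := by
    have hd : diagonal (fun i => ((hS.1.eigenvalues i - s : ℝ) : ℂ))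
        = diagonal (fun i => (hS.1.eigenvalues i : ℂ)) - (s : ℂ) • (1 : Matrix (Fin N) (Fin N) ℂ) := by
      ext i j
      by_cases hij : i = j
      · subst hij; simp
      · simp [hij]
    rw [hd, mul_sub, sub_mul, ← h3]
    simp [h2]
  rw [this]
  apply PosSemidef.mul_mul_conjTranspose_same
  rw [posSemidef_diagonal_iff]
  intro i
  exact_mod_cast sub_nonneg.2 (hle i)

theorem aux_trace {N : ℕ} (S M : Matrix (Fin N) (Fin N) ℂ) (hM : M.PosDef) (s : ℝ)
    (hs : (S - (s : ℂ) • (1 : Matrix (Fin N) (Fin N) ℂ)).PosSemidef) :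
    ∑ i, s / hM.1.eigenvalues i ≤ ((M⁻¹ * S).trace).re := by
  obtain ⟨U, h1, h2, h3⟩ := aux_spec M hM.1
  have hpos := fun i => hM.eigenvalues_pos i
  have hinv : M⁻¹ = U * diagonal (fun i => ((hM.1.eigenvalues i)⁻¹ : ℂ)) * Uᴴ := by
    apply Matrix.inv_eq_right_inv
    refine (congrArg (· * _) h3).trans ?_
    calc _ = U * (diagonal (fun i => (hM.1.eigenvalues i : ℂ)) * (Uᴴ * U) *
            diagonal (fun i => ((hM.1.eigenvalues i)⁻¹ : ℂ))) * Uᴴ := by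
          simp only [Matrix.mul_assoc]
      _ = 1 := by
          rw [h1, Matrix.mul_one, diagonal_mul_diagonal]
          have : (fun i => (hM.1.eigenvalues i : ℂ) * (hM.1.eigenvalues i : ℂ)⁻¹) = fun _ => 1 := by
            funext i
            exact mul_inv_cancel₀ (by exact_mod_cast (hpos i).ne')
          rw [this, diagonal_one, Matrix.mul_one, h2]
  have ht : (M⁻¹ * S).trace = ∑ i, ((hM.1.eigenvalues i)⁻¹ : ℂ) * (Uᴴ * S * U) i i := by
    rw [hinv, Matrix.mul_assoc, Matrix.mul_assoc, Matrix.trace_mul_comm, Matrix.mul_assoc]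
    simp [Matrix.trace, Matrix.diagonal_mul]
  rw [ht, Complex.re_sum]
  apply Finset.sum_le_sum
  intro i _
  have hP := (hs.conjTranspose_mul_mul_same U).diag_nonneg (i := i)
  rw [mul_sub, sub_mul] at hP
  simp only [Matrix.mul_smul, Matrix.smul_mul, Matrix.mul_one, h1] at hP
  have hP2 := (Complex.le_def.1 hP).1
  simp at hP2
  rw [← Complex.ofReal_inv, Complex.re_ofReal_mul, div_eq_inv_mul]
  exact mul_le_mul_of_nonneg_left hP2 (inv_nonneg.2 (hpos i).le)

/-- for Hermitian positive definite `Σ`, the superlevel sets of `g_Σ` on the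
positive definite cone are bounded and bounded away from the boundary: for every `c` there are
`a, b > 0` such that any Hermitian positive definite `M` with `g_Σ(M) ≥ c` satisfies
`λ_min(M) ≥ a` and `tr(M) ≤ b`. -/
theorem stmt4 {N : ℕ} (hN : 0 < N)
    (S : Matrix (Fin N) (Fin N) ℂ) (hS : S.PosDef) :
    ∀ c : ℝ, ∃ a b : ℝ, 0 < a ∧ 0 < b ∧
      ∀ M : Matrix (Fin N) (Fin N) ℂ, ∀ hM : M.PosDef,
        c ≤ gFun S M →
          a ≤ (⨅ j : Fin N, hM.1.eigenvalues j) ∧ M.trace.re ≤ b := by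
  intro c
  obtain ⟨s, hs, hsS⟩ := aux_lower S hS
  haveI : Nonempty (Fin N) := ⟨⟨0, hN⟩⟩
  have hNR : (0 : ℝ) < N := by exact_mod_cast hN
  set K : ℝ := -1 - Real.log s with hK
  set d : ℝ := c - (N - 1) * K with hd
  set T : ℝ := max 1 (-1 - Real.log (s / 2) - d) with hT
  have hT0 : 0 < T := lt_of_lt_of_le one_pos (le_max_left _ _)
  refine ⟨s / 2 / T, N * Real.exp (-d), by positivity, by positivity, ?_⟩
  intro M hM hc
  have hpos := fun i => hM.eigenvalues_pos i
  have htr := aux_trace S M hM s hsS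
  have hdet : Real.log M.det.re = ∑ i, Real.log (hM.1.eigenvalues i) := by
    rw [hM.1.det_eq_prod_eigenvalues]
    have : (∏ i, ((hM.1.eigenvalues i : ℝ) : ℂ)).re = ∏ i, hM.1.eigenvalues i := by
      rw [← Complex.ofReal_prod, Complex.ofReal_re]
    refine (congrArg Real.log this).trans ?_
    exact Real.log_prod (fun i _ => (hpos i).ne')
  have hsum : c ≤ ∑ i, (-Real.log (hM.1.eigenvalues i) - s / hM.1.eigenvalues i) := by
    rw [Finset.sum_sub_distrib, Finset.sum_neg_distrib, ← hdet]
    unfold gFun at hc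
    linarith
  have hub : ∀ i, -Real.log (hM.1.eigenvalues i) - s / hM.1.eigenvalues i ≤ K := by
    intro i
    have h := Real.log_le_sub_one_of_pos (div_pos hs (hpos i))
    rw [Real.log_div hs.ne' (hpos i).ne'] at h
    linarith
  have hlb : ∀ i, d ≤ -Real.log (hM.1.eigenvalues i) - s / hM.1.eigenvalues i := by
    intro i
    rw [← Finset.add_sum_erase _ _ (Finset.mem_univ i)] at hsum
    have h := Finset.sum_le_card_nsmul (Finset.univ.erase i) _ K (fun j _ => hub j)
    rw [Finset.card_erase_of_mem (Finset.mem_univ i), Finset.card_univ, Fintype.card_fin,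
      nsmul_eq_mul, Nat.cast_sub hN, Nat.cast_one] at h
    linarith
  constructor
  · apply le_ciInf
    intro i
    have h := Real.log_le_sub_one_of_pos (div_pos (half_pos hs) (hpos i))
    rw [Real.log_div (half_pos hs).ne' (hpos i).ne'] at h
    have h2 : s / hM.1.eigenvalues i = 2 * (s / 2 / hM.1.eigenvalues i) := by ring
    have h3 := hlb i
    have h4 : s / 2 / hM.1.eigenvalues i ≤ T := by
      refine le_trans ?_ (le_max_right _ _)
      linarith
    rw [div_le_iff₀ (hpos i)] at h4
    rw [div_le_iff₀ hT0]
    linarith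
  · have htrace : M.trace.re = ∑ i, hM.1.eigenvalues i := by
      rw [hM.1.trace_eq_sum_eigenvalues]
      simp
    rw [htrace]
    have h := Finset.sum_le_card_nsmul Finset.univ hM.1.eigenvalues (Real.exp (-d)) (fun i _ => by
      rw [← Real.log_le_iff_le_exp (hpos i)]
      have := div_pos hs (hpos i)
      have := hlb i
      linarith)
    simpa using h
end
end

section
/- Let Σ ∈ ℂ^{N×N} be Hermitian positive definite. For every Hermitian positive definite M ∈ ℂ^{N×N}, g_Σ(M) ≤ −ln det Σ − N, and equality holds if and only if M = Σ. In particular M = Σ is the unique maximizer of g_Σ over the Hermitian positive definite matrices. -/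
open Matrix
open scoped ComplexOrder

noncomputable section

theorem aux_key {N : ℕ} (A : Matrix (Fin N) (Fin N) ℂ) (hA : A.PosDef) :
    Real.log A.det.re ≤ A.trace.re - N ∧ (Real.log A.det.re = A.trace.re - N → A = 1) := by
  have hd : A.det.re = ∏ i, hA.1.eigenvalues i := by
    rw [hA.1.det_eq_prod_eigenvalues]
    have := Complex.ofReal_prod Finset.univ (fun i => hA.1.eigenvalues i)
    exact (congrArg Complex.re this.symm).trans (Complex.ofReal_re _)
  have ht : A.trace.re = ∑ i, hA.1.eigenvalues i := by
    rw [hA.1.trace_eq_sum_eigenvalues]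
    have := Complex.ofReal_sum Finset.univ (fun i => hA.1.eigenvalues i)
    exact (congrArg Complex.re this.symm).trans (Complex.ofReal_re _)
  have hl : Real.log A.det.re = ∑ i, Real.log (hA.1.eigenvalues i) := by
    rw [hd, Real.log_prod (fun i _ => (hA.eigenvalues_pos i).ne')]
  have hs : A.trace.re - N = ∑ i, (hA.1.eigenvalues i - 1) := by
    rw [ht]; simp
  have hle : ∀ i ∈ Finset.univ, Real.log (hA.1.eigenvalues i) ≤ hA.1.eigenvalues i - 1 :=
    fun i _ => Real.log_le_sub_one_of_pos (hA.eigenvalues_pos i)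
  rw [hl, hs]
  refine ⟨Finset.sum_le_sum hle, fun h => ?_⟩
  rw [Finset.sum_eq_sum_iff_of_le hle] at h
  have h1 : ∀ i, hA.1.eigenvalues i = 1 := by
    intro i
    by_contra hne
    exact (Real.log_lt_sub_one_of_pos (hA.eigenvalues_pos i) hne).ne (h i (Finset.mem_univ i))
  have h2 : (diagonal (RCLike.ofReal ∘ hA.1.eigenvalues) : Matrix (Fin N) (Fin N) ℂ) = 1 := by
    rw [← diagonal_one]
    congr 1
    ext i
    simp [h1]
  rw [hA.1.spectral_theorem, h2, map_one]

open scoped MatrixOrder in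
theorem aux_fac {N : ℕ} (A : Matrix (Fin N) (Fin N) ℂ) (hA : A.PosDef) :
    ∃ B : Matrix (Fin N) (Fin N) ℂ, A = Bᴴ * B := by
  obtain ⟨B, hB⟩ := CStarAlgebra.nonneg_iff_eq_star_mul_self.mp hA.posSemidef.nonneg
  exact ⟨B, hB⟩

theorem stmt5 {N : ℕ} (S : Matrix (Fin N) (Fin N) ℂ) (hS : S.PosDef) :
    ∀ M : Matrix (Fin N) (Fin N) ℂ, M.PosDef →
      gFun S M ≤ -Real.log (S.det.re) - (N : ℝ) ∧
      (gFun S M = -Real.log (S.det.re) - (N : ℝ) ↔ M = S) := by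
  intro M hM
  obtain ⟨B, hB⟩ := aux_fac M⁻¹ hM.inv
  have hMu : IsUnit M.det := hM.det_pos.ne'.isUnit
  have hBd : B.det ≠ 0 := by
    intro h0
    have := hM.inv.det_pos.ne'
    rw [hB, det_mul, h0, mul_zero] at this
    exact this rfl
  have hBu : IsUnit B := (Matrix.isUnit_iff_isUnit_det B).2 hBd.isUnit
  have hA : (B * S * Bᴴ).PosDef :=
    hS.mul_mul_conjTranspose_same (vecMul_injective_of_isUnit hBu)
  obtain ⟨k1, k2⟩ := aux_key _ hA
  have htr : (B * S * Bᴴ).trace = (M⁻¹ * S).trace := by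
    rw [hB, trace_mul_comm, Matrix.mul_assoc]
  have hdet : (B * S * Bᴴ).det * M.det = S.det := by
    have h1 : (Bᴴ * B).det * M.det = 1 := by
      rw [← hB, ← det_mul, nonsing_inv_mul _ hMu, det_one]
    rw [det_mul] at h1
    rw [det_mul, det_mul]
    linear_combination S.det * h1
  have pA := Complex.pos_iff.1 hA.det_pos
  have pM := Complex.pos_iff.1 hM.det_pos
  have hre : (B * S * Bᴴ).det.re * M.det.re = S.det.re := by
    rw [← hdet, Complex.mul_re, ← pM.2]; simp
  have hlog : Real.log S.det.re = Real.log (B * S * Bᴴ).det.re + Real.log M.det.re := by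
    rw [← hre, Real.log_mul pA.1.ne' pM.1.ne']
  rw [htr] at k1 k2
  unfold gFun
  refine ⟨by linarith, fun h => ?_, ?_⟩
  · have h1 : B * S * Bᴴ = 1 := k2 (by linarith)
    have h2 : Bᴴ * (B * S) = 1 := mul_eq_one_comm.1 h1
    rw [← Matrix.mul_assoc, ← hB] at h2
    calc M = M * (M⁻¹ * S) := by rw [h2, mul_one]
      _ = S := mul_nonsing_inv_cancel_left _ _ hMu
  · rintro rfl
    rw [nonsing_inv_mul _ hMu]
    simp
end
end

section
/- Let Σ ∈ ℂ^{N×N} be Hermitian positive definite and let C be a nonempty closed subset of the real vector space of N×N Hermitian matrices such that every element of C is positive definite. Then g_Σ attains its maximum over C, i.e., there exists M* ∈ C with g_Σ(M*) ≥ g_Σ(M) for all M ∈ C. -/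
open Matrix
open scoped ComplexOrder

noncomputable section

theorem aux_shift {N : ℕ} (S : Matrix (Fin N) (Fin N) ℂ) (hS : S.IsHermitian) (c : ℝ)
    (h : ∀ i, c ≤ hS.eigenvalues i) : (S - (c : ℂ) • (1 : Matrix (Fin N) (Fin N) ℂ)).PosSemidef := by
  set U : Matrix (Fin N) (Fin N) ℂ := (hS.eigenvectorUnitary : Matrix (Fin N) (Fin N) ℂ) with hU
  have hUU : U * Uᴴ = 1 := by
    have := (Matrix.mem_unitaryGroup_iff).1 hS.eigenvectorUnitary.2
    simpa [Matrix.star_eq_conjTranspose] using this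
  have hsp : S = U * diagonal (fun i => (hS.eigenvalues i : ℂ)) * Uᴴ := by
    have := hS.spectral_theorem
    rw [Unitary.conjStarAlgAut_apply] at this
    simpa [Matrix.star_eq_conjTranspose, Function.comp_def] using this
  have hd : (diagonal (fun i => ((hS.eigenvalues i - c : ℝ) : ℂ))).PosSemidef := by
    apply Matrix.PosSemidef.diagonal
    intro i
    simp only [Pi.zero_apply]
    exact_mod_cast sub_nonneg.2 (h i)
  have h2 := hd.mul_mul_conjTranspose_same U
  have e : S - (c : ℂ) • (1 : Matrix (Fin N) (Fin N) ℂ)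
      = U * diagonal (fun i => ((hS.eigenvalues i - c : ℝ) : ℂ)) * Uᴴ := by
    have : diagonal (fun i => ((hS.eigenvalues i - c : ℝ) : ℂ))
        = diagonal (fun i => (hS.eigenvalues i : ℂ)) - (c : ℂ) • (1 : Matrix (Fin N) (Fin N) ℂ) := by
      ext i j
      by_cases hij : i = j
      · subst hij; simp
      · simp [hij]
    rw [this, Matrix.mul_sub, Matrix.sub_mul, ← hsp]
    simp [hUU]
  rw [e]; exact h2

theorem aux_c {N : ℕ} (S : Matrix (Fin N) (Fin N) ℂ) (hS : S.PosDef) :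
    ∃ c : ℝ, 0 < c ∧ (S - (c : ℂ) • (1 : Matrix (Fin N) (Fin N) ℂ)).PosSemidef := by
  have : ∃ c : ℝ, 0 < c ∧ ∀ i, c ≤ hS.1.eigenvalues i := by
    rcases isEmpty_or_nonempty (Fin N) with h | h
    · exact ⟨1, one_pos, fun i => h.elim i⟩
    · obtain ⟨i, hi⟩ := Finite.exists_min hS.1.eigenvalues
      exact ⟨_, hS.eigenvalues_pos i, hi⟩
  obtain ⟨c, hc, h⟩ := this
  exact ⟨c, hc, aux_shift S hS.1 c h⟩

theorem aux_trace_s6 {N : ℕ} (P Q : Matrix (Fin N) (Fin N) ℂ) (hP : P.PosSemidef)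
    (hQ : Q.PosSemidef) : 0 ≤ ((P * Q).trace).re := by
  obtain ⟨B, rfl⟩ : ∃ B : Matrix (Fin N) (Fin N) ℂ, P = Bᴴ * B := by
    open scoped MatrixOrder in
    obtain ⟨B, hB⟩ := CStarAlgebra.nonneg_iff_eq_star_mul_self.1 hP.nonneg
    exact ⟨B, hB⟩
  have := (hQ.mul_mul_conjTranspose_same B).trace_nonneg
  rw [Matrix.mul_assoc, Matrix.trace_mul_comm]
  exact (Complex.le_def.1 this).1

theorem aux_g {N : ℕ} (S M : Matrix (Fin N) (Fin N) ℂ) (c : ℝ)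
    (hc : (S - (c : ℂ) • (1 : Matrix (Fin N) (Fin N) ℂ)).PosSemidef) (hM : M.PosDef) :
    gFun S M ≤ ∑ i, (Real.log (hM.inv.1.eigenvalues i) - c * hM.inv.1.eigenvalues i) := by
  have h1 := aux_trace_s6 _ _ hM.inv.posSemidef hc
  have ht := hM.inv.1.trace_eq_sum_eigenvalues
  have hd := hM.inv.1.det_eq_prod_eigenvalues
  have hpos := hM.inv.eigenvalues_pos
  rw [Matrix.mul_sub, Matrix.trace_sub, Matrix.mul_smul, Matrix.mul_one, Matrix.trace_smul, ht] at h1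
  have hdet : M.det = ((∏ i, hM.inv.1.eigenvalues i : ℝ) : ℂ)⁻¹ := by
    rw [Matrix.det_nonsing_inv, Ring.inverse_eq_inv'] at hd
    rw [← inv_inv M.det, hd]; simp
  have hl : -Real.log M.det.re = ∑ i, Real.log (hM.inv.1.eigenvalues i) := by
    rw [hdet, ← Complex.ofReal_inv, Complex.ofReal_re, Real.log_inv, neg_neg, Real.log_prod]
    intro i _; exact (hpos i).ne'
  unfold gFun
  rw [hl, Finset.sum_sub_distrib, ← Finset.mul_sum]
  have : ((c:ℂ) • ∑ i, ((hM.inv.1.eigenvalues i : ℝ) : ℂ)).re = c * ∑ i, hM.inv.1.eigenvalues i := by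
    rw [← Complex.ofReal_sum, smul_eq_mul, ← Complex.ofReal_mul, Complex.ofReal_re]
  simp only [Complex.sub_re] at h1
  erw [this] at h1
  linarith

theorem aux_log (c x : ℝ) (hc : 0 < c) (hx : 0 < x) : Real.log x - c * x ≤ -Real.log c - 1 := by
  have := Real.log_le_sub_one_of_pos (mul_pos hc hx)
  rw [Real.log_mul hc.ne' hx.ne'] at this
  linarith

theorem aux_delta {N : ℕ} (S : Matrix (Fin N) (Fin N) ℂ) (c g0 : ℝ) (hc0 : 0 < c)
    (hc : (S - (c : ℂ) • (1 : Matrix (Fin N) (Fin N) ℂ)).PosSemidef) :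
    ∃ δ : ℝ, 0 < δ ∧ ∀ M : Matrix (Fin N) (Fin N) ℂ, ∀ hM : M.PosDef, g0 ≤ gFun S M →
      ∀ i, δ ≤ hM.inv.1.eigenvalues i := by
  set B := -Real.log c - 1
  refine ⟨Real.exp (g0 - (N - 1) * B), Real.exp_pos _, fun M hM hg i => ?_⟩
  have h := hg.trans (aux_g S M c hc hM)
  have hpos := hM.inv.eigenvalues_pos
  rw [← Finset.add_sum_erase _ _ (Finset.mem_univ i)] at h
  have h2 : ∑ j ∈ Finset.univ.erase i,
      (Real.log (hM.inv.1.eigenvalues j) - c * hM.inv.1.eigenvalues j) ≤ (N - 1) * B := by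
    refine (Finset.sum_le_card_nsmul _ _ B fun j _ => aux_log c _ hc0 (hpos j)).trans ?_
    have hN : 1 ≤ N := i.pos
    simp [Finset.card_erase_of_mem, Nat.cast_sub hN]
  have h3 := mul_pos hc0 (hpos i)
  rw [← Real.le_log_iff_exp_le (hpos i)]
  linarith

theorem aux_bd {N : ℕ} (M : Matrix (Fin N) (Fin N) ℂ) (hM : M.PosDef) (δ : ℝ) (hδ : 0 < δ)
    (h : ∀ i, δ ≤ hM.inv.1.eigenvalues i) (i j : Fin N) : ‖M i j‖ ≤ δ⁻¹ := by
  have h1 := (aux_shift _ hM.inv.1 δ h).mul_mul_conjTranspose_same M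
  have hu : IsUnit M.det := hM.det_pos.ne'.isUnit
  rw [Matrix.mul_sub, Matrix.sub_mul, Matrix.mul_nonsing_inv _ hu, Matrix.one_mul, hM.1.eq] at h1
  have h2 := h1.diag_nonneg (i := i)
  have h3 := (Complex.le_def.1 h2).1
  have hs : (M * M) i i = ((∑ k, ‖M i k‖ ^ 2 : ℝ) : ℂ) := by
    rw [Matrix.mul_apply, Complex.ofReal_sum]
    refine Finset.sum_congr rfl fun k _ => ?_
    rw [← hM.1.apply k i]
    simpa using Complex.mul_conj' (M i k)
  have h4 : δ * ∑ k, ‖M i k‖ ^ 2 ≤ (M i i).re := by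
    simp only [Matrix.mul_smul, Matrix.mul_one, Matrix.smul_mul, Matrix.sub_apply,
      Matrix.smul_apply, hs, smul_eq_mul, ← Complex.ofReal_mul, Complex.sub_re,
      Complex.ofReal_re, Complex.zero_re] at h3
    linarith
  have h5 : ∀ k, δ * ‖M i k‖ ^ 2 ≤ ‖M i i‖ := fun k => by
    refine le_trans ?_ (h4.trans (Complex.re_le_norm _))
    exact mul_le_mul_of_nonneg_left
      (Finset.single_le_sum (f := fun k => ‖M i k‖ ^ 2) (fun _ _ => sq_nonneg _)
        (Finset.mem_univ k)) hδ.le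
  have key : ∀ a b : ℝ, 0 ≤ a → b ≤ δ⁻¹ → δ * a ^ 2 ≤ b → a ≤ δ⁻¹ := by
    intro a b ha hb hab
    have : a ^ 2 ≤ (δ⁻¹) ^ 2 := by
      have h6 : a ^ 2 = δ⁻¹ * (δ * a ^ 2) := by field_simp
      rw [h6, sq δ⁻¹]
      exact mul_le_mul_of_nonneg_left (hab.trans hb) (by positivity)
    exact le_of_sq_le_sq this (by positivity)
  have h6 : ‖M i i‖ ≤ δ⁻¹ := by
    rcases (norm_nonneg (M i i)).eq_or_lt with h0 | h0
    · rw [← h0]; positivity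
    · rw [le_inv_comm₀ h0 hδ, ← mul_le_mul_iff_left₀ h0, inv_mul_cancel₀ h0.ne'] 
      have := h5 i
      by_contra! hlt
      nlinarith
  exact key _ _ (norm_nonneg _) h6 (h5 j)

theorem aux_cont {N : ℕ} (S : Matrix (Fin N) (Fin N) ℂ) (C : Set (Matrix (Fin N) (Fin N) ℂ))
    (hpos : ∀ M ∈ C, M.PosDef) : ContinuousOn (gFun S) C := by
  have hdet : ContinuousOn (fun M : Matrix (Fin N) (Fin N) ℂ => M.det) C :=
    (continuous_id.matrix_det).continuousOn
  have hinv : ContinuousOn (fun M : Matrix (Fin N) (Fin N) ℂ => M⁻¹) C := by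
    simp only [Matrix.inv_def, Ring.inverse_eq_inv']
    exact (hdet.inv₀ fun M hM => (hpos M hM).det_pos.ne').smul
      (continuous_id.matrix_adjugate).continuousOn
  unfold gFun
  refine ContinuousOn.sub (ContinuousOn.neg (ContinuousOn.log
    (Complex.continuous_re.comp_continuousOn hdet) fun M hM => ?_)) ?_
  · exact (Complex.lt_def.1 (hpos M hM).det_pos).1.ne'
  · have ht : Continuous fun M : Matrix (Fin N) (Fin N) ℂ => ((M * S).trace).re :=
      Complex.continuous_re.comp (continuous_id.matrix_mul continuous_const).matrix_trace
    exact ht.comp_continuousOn hinv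

theorem stmt6 {N : ℕ} (S : Matrix (Fin N) (Fin N) ℂ) (hS : S.PosDef)
    (C : Set (Matrix (Fin N) (Fin N) ℂ)) (hne : C.Nonempty) (hclosed : IsClosed C)
    (hpos : ∀ M ∈ C, M.PosDef) :
    ∃ Mstar ∈ C, ∀ M ∈ C, gFun S M ≤ gFun S Mstar := by
  obtain ⟨M0, hM0⟩ := hne
  obtain ⟨c, hc0, hc⟩ := aux_c S hS
  obtain ⟨δ, hδ, h⟩ := aux_delta S c (gFun S M0) hc0 hc
  have hb : ∀ M ∈ C, gFun S M0 ≤ gFun S M → ∀ i j, ‖M i j‖ ≤ δ⁻¹ := fun M hM hg =>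
    aux_bd M (hpos M hM) δ hδ (h M (hpos M hM) hg)
  have hK : IsCompact (Set.univ.pi fun _ : Fin N => Set.univ.pi fun _ : Fin N =>
      Metric.closedBall (0 : ℂ) δ⁻¹) :=
    isCompact_univ_pi fun _ => isCompact_univ_pi fun _ => isCompact_closedBall _ _
  have hK' : IsCompact (C ∩ {M : Matrix (Fin N) (Fin N) ℂ | ∀ i j, ‖M i j‖ ≤ δ⁻¹}) := by
    refine IsCompact.inter_left ?_ hclosed
    have e : {M : Matrix (Fin N) (Fin N) ℂ | ∀ i j, ‖M i j‖ ≤ δ⁻¹} =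
        (Set.univ.pi fun _ : Fin N => Set.univ.pi fun _ : Fin N =>
          Metric.closedBall (0 : ℂ) δ⁻¹) := by
      ext M
      constructor
      · intro hM i _ j _
        exact mem_closedBall_zero_iff.2 (hM i j)
      · intro hM i j
        exact mem_closedBall_zero_iff.1 (hM i trivial j trivial)
    rw [e]
    exact hK
  obtain ⟨Ms, hMs, hmax⟩ := hK'.exists_isMaxOn ⟨M0, hM0, hb M0 hM0 le_rfl⟩
    ((aux_cont S C hpos).mono Set.inter_subset_left)
  refine ⟨Ms, hMs.1, fun M hM => ?_⟩
  rcases le_total (gFun S M0) (gFun S M) with hg | hg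
  · exact hmax ⟨hM, hb M hM hg⟩
  · exact hg.trans (hmax ⟨hM0, hb M0 hM0 le_rfl⟩)
end
end

section
/- Let Σ ∈ ℂ^{N×N} be Hermitian positive definite with spectral decomposition Σ = ∑_{v=1}^N λ̃_v u_v u_v† (λ̃_v its eigenvalues, u_v an orthonormal basis of eigenvectors), and let σ² > 0. Then the matrix M̂ = ∑_{v=1}^N max(λ̃_v, σ²) u_v u_v† belongs to the set {M ∈ ℂ^{N×N} Hermitian : M − σ² I is positive semidefinite} and maximizes g_Σ over this set. -/
open Matrix
open scoped ComplexOrder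

noncomputable section

lemma logdet_le {N : ℕ} (Z : Matrix (Fin N) (Fin N) ℂ) (hZ : Z.PosDef) :
    Real.log Z.det.re ≤ Z.trace.re - N := by
  have h1 := hZ.isHermitian.det_eq_prod_eigenvalues
  have h2 := hZ.isHermitian.trace_eq_sum_eigenvalues
  have hp := hZ.eigenvalues_pos
  have h3 : Z.det.re = ∏ i, hZ.isHermitian.eigenvalues i := by
    rw [h1]; simp only [Complex.coe_algebraMap, ← Complex.ofReal_prod]
    norm_cast
  have h4 : Z.trace.re = ∑ i, hZ.isHermitian.eigenvalues i := by
    rw [h2]; simp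
  rw [h3, h4, Real.log_prod (fun i _ => (hp i).ne')]
  calc _ ≤ ∑ i, (hZ.isHermitian.eigenvalues i - 1) :=
        Finset.sum_le_sum fun i _ => Real.log_le_sub_one_of_pos (hp i)
    _ = _ := by simp

lemma posdef_of {N : ℕ} (σsq : ℝ) (hσ : 0 < σsq) (M : Matrix (Fin N) (Fin N) ℂ)
    (h : (M - (σsq : ℂ) • (1 : Matrix (Fin N) (Fin N) ℂ)).PosSemidef) : M.PosDef := by
  have h1 : ((σsq : ℂ) • (1 : Matrix (Fin N) (Fin N) ℂ)).PosDef :=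
    Matrix.PosDef.one.smul (by exact_mod_cast hσ)
  simpa using Matrix.PosDef.posSemidef_add h h1

lemma diag_bound {N : ℕ} (σsq : ℝ) (hσ : 0 < σsq) (W : Matrix (Fin N) (Fin N) ℂ)
    (h : (W - (σsq : ℂ) • (1 : Matrix (Fin N) (Fin N) ℂ)).PosSemidef) (v : Fin N) :
    σsq * (W⁻¹ v v).re ≤ 1 := by
  have hW := posdef_of σsq hσ W h
  have hu : IsUnit W.det := (Matrix.isUnit_iff_isUnit_det _).1 hW.isUnit
  have hY := hW.inv
  have hH : W⁻¹ᴴ = W⁻¹ := hY.isHermitian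
  have hc := h.conjTranspose_mul_mul_same W⁻¹
  have e : W⁻¹ᴴ * (W - (σsq : ℂ) • (1 : Matrix (Fin N) (Fin N) ℂ)) * W⁻¹
      = W⁻¹ - (σsq : ℂ) • (W⁻¹ᴴ * W⁻¹) := by
    rw [Matrix.mul_sub, Matrix.sub_mul, hH, Matrix.nonsing_inv_mul _ hu]
    simp
  rw [e] at hc
  have hd := (Complex.le_def.1 (hc.diag_nonneg (i := v))).1
  have hsq : (W⁻¹ v v).re ^ 2 ≤ ((W⁻¹ᴴ * W⁻¹) v v).re := by
    rw [Matrix.mul_apply, Complex.re_sum]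
    have hnn : ∀ i ∈ Finset.univ, 0 ≤ (W⁻¹ᴴ v i * W⁻¹ i v).re := by
      intro i _
      simp only [Matrix.conjTranspose_apply, Complex.star_def, Complex.mul_re, Complex.conj_re,
        Complex.conj_im]
      nlinarith [sq_nonneg (W⁻¹ i v).re, sq_nonneg (W⁻¹ i v).im]
    refine le_trans ?_ (Finset.single_le_sum hnn (Finset.mem_univ v))
    simp only [Matrix.conjTranspose_apply, Complex.star_def, Complex.mul_re, Complex.conj_re,
        Complex.conj_im]
    nlinarith [sq_nonneg (W⁻¹ v v).re, sq_nonneg (W⁻¹ v v).im]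
  have hpos : 0 < (W⁻¹ v v).re := (Complex.lt_def.1 (hY.diag_pos (i := v))).1
  simp at hd
  have : σsq * (W⁻¹ v v).re ^ 2 ≤ (W⁻¹ v v).re := by nlinarith
  by_contra hcon
  push Not at hcon
  nlinarith

lemma diag_case {N : ℕ} (σsq : ℝ) (hσ : 0 < σsq) (lam : Fin N → ℝ)
    (W : Matrix (Fin N) (Fin N) ℂ)
    (h : (W - (σsq : ℂ) • (1 : Matrix (Fin N) (Fin N) ℂ)).PosSemidef) :
    gFun (Matrix.diagonal fun v => (lam v : ℂ)) W ≤
      gFun (Matrix.diagonal fun v => (lam v : ℂ))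
        (Matrix.diagonal fun v => ((max (lam v) σsq : ℝ) : ℂ)) := by
  have hW := posdef_of σsq hσ W h
  have hY := hW.inv
  set d : Fin N → ℝ := fun v => max (lam v) σsq with hd
  have hdpos : ∀ v, 0 < d v := fun v => lt_of_lt_of_le hσ (le_max_right _ _)
  set E : Matrix (Fin N) (Fin N) ℂ := Matrix.diagonal fun v => ((Real.sqrt (d v) : ℝ) : ℂ) with hE
  have hEH : Eᴴ = E := by
    rw [hE, Matrix.diagonal_conjTranspose]; congr 1; ext v; simp
  have hEE : E * E = Matrix.diagonal fun v => (d v : ℂ) := by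
    rw [hE, Matrix.diagonal_mul_diagonal]; congr 1; ext v
    rw [← Complex.ofReal_mul, Real.mul_self_sqrt (hdpos v).le]
  have hEu : IsUnit E := by
    rw [Matrix.isUnit_iff_isUnit_det, hE, Matrix.det_diagonal, isUnit_iff_ne_zero,
      Finset.prod_ne_zero_iff]
    intro v _
    exact_mod_cast (Real.sqrt_pos.2 (hdpos v)).ne'
  have hZ : (Eᴴ * W⁻¹ * E).PosDef :=
    hY.conjTranspose_mul_mul_same (Matrix.mulVec_injective_of_isUnit hEu)
  rw [hEH] at hZ
  have key := logdet_le _ hZ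
  have hWd := Complex.lt_def.1 hW.det_pos
  have hWr : W.det = (W.det.re : ℂ) := by
    apply Complex.ext <;> simp [← hWd.2]
  have hdet : (E * W⁻¹ * E).det.re = (∏ v, d v) * (W.det.re)⁻¹ := by
    have : (E * W⁻¹ * E).det = (E * E).det * W⁻¹.det := by
      simp only [Matrix.det_mul]; ring
    rw [this, hEE, Matrix.det_diagonal, Matrix.det_nonsing_inv, Ring.inverse_eq_inv', hWr]
    rw [← Complex.ofReal_prod, ← Complex.ofReal_inv, ← Complex.ofReal_mul, Complex.ofReal_re,
      Complex.ofReal_re]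
  have htr : (E * W⁻¹ * E).trace.re = ∑ v, (W⁻¹ v v).re * d v := by
    rw [Matrix.mul_assoc, Matrix.trace_mul_comm, Matrix.mul_assoc, hEE]
    simp [Matrix.trace, Matrix.mul_diagonal]
  have hP : 0 < ∏ v, d v := Finset.prod_pos fun v _ => hdpos v
  have hw0 : 0 < W.det.re := hWd.1
  rw [hdet, htr, Real.log_mul hP.ne' (inv_pos.2 hw0).ne', Real.log_inv] at key
  have hL : gFun (Matrix.diagonal fun v => (lam v : ℂ)) W
      = - Real.log W.det.re - ∑ v, (W⁻¹ v v).re * lam v := by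
    simp [gFun, Matrix.trace, Matrix.mul_diagonal]
  have hinv : (Matrix.diagonal fun v => (d v : ℂ))⁻¹ = Matrix.diagonal fun v => ((d v)⁻¹ : ℂ) := by
    apply Matrix.inv_eq_left_inv
    rw [Matrix.diagonal_mul_diagonal, ← Matrix.diagonal_one]
    congr 1; ext v
    exact inv_mul_cancel₀ (by exact_mod_cast (hdpos v).ne')
  have hR : gFun (Matrix.diagonal fun v => (lam v : ℂ)) (Matrix.diagonal fun v => (d v : ℂ))
      = - Real.log (∏ v, d v) - ∑ v, (d v)⁻¹ * lam v := by
    unfold gFun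
    rw [hinv, Matrix.diagonal_mul_diagonal, Matrix.det_diagonal, Matrix.trace_diagonal,
      ← Complex.ofReal_prod, Complex.ofReal_re, Complex.re_sum]
    congr 2; ext v
    rw [← Complex.ofReal_inv, ← Complex.ofReal_mul, Complex.ofReal_re]
  have hsum : ∑ v, (W⁻¹ v v).re * d v - ∑ v, (W⁻¹ v v).re * lam v ≤ N - ∑ v, (d v)⁻¹ * lam v := by
    have hN : (N : ℝ) = ∑ v : Fin N, (1 : ℝ) := by simp
    rw [hN, ← Finset.sum_sub_distrib, ← Finset.sum_sub_distrib]
    refine Finset.sum_le_sum fun v _ => ?_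
    have hb := diag_bound σsq hσ W h v
    rcases le_total σsq (lam v) with hc | hc
    · have : d v = lam v := max_eq_left hc
      have h0 := hdpos v
      rw [← this, inv_mul_cancel₀ h0.ne']; simp
    · have : d v = σsq := max_eq_right hc
      rw [this]
      have e : 1 - σsq⁻¹ * lam v = σsq⁻¹ * (σsq - lam v) := by field_simp
      rw [e, ← mul_sub]
      apply mul_le_mul_of_nonneg_right _ (by linarith)
      rw [inv_eq_one_div σsq, le_div_iff₀ hσ]; linarith
  change _ ≤ gFun (Matrix.diagonal fun v => (lam v : ℂ)) (Matrix.diagonal fun v => (d v : ℂ))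
  rw [hL, hR]; linarith

lemma gFun_conj {N : ℕ} (U A B : Matrix (Fin N) (Fin N) ℂ) (h1 : Uᴴ * U = 1) (h2 : U * Uᴴ = 1) :
    gFun (U * A * Uᴴ) (U * B * Uᴴ) = gFun A B := by
  have hi : U⁻¹ = Uᴴ := Matrix.inv_eq_left_inv h1
  have hi2 : Uᴴ⁻¹ = U := Matrix.inv_eq_left_inv h2
  unfold gFun
  have e1 : (U * B * Uᴴ).det = B.det := by
    rw [Matrix.det_mul, Matrix.det_mul, mul_comm, ← mul_assoc, ← Matrix.det_mul, h1]; simp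
  have e2 : ((U * B * Uᴴ)⁻¹ * (U * A * Uᴴ)).trace = (B⁻¹ * A).trace := by
    rw [Matrix.mul_inv_rev, Matrix.mul_inv_rev, hi, hi2]
    have : U * (B⁻¹ * Uᴴ) * (U * A * Uᴴ) = U * (B⁻¹ * A * Uᴴ) := by
      calc _ = U * (B⁻¹ * (Uᴴ * U) * (A * Uᴴ)) := by simp only [Matrix.mul_assoc]
        _ = _ := by rw [h1]; simp only [Matrix.mul_assoc, Matrix.mul_one]
    rw [this, Matrix.trace_mul_comm, Matrix.mul_assoc, h1, Matrix.mul_one]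
  rw [e1, e2]

lemma sum_eq {N : ℕ} (u : Fin N → (Fin N → ℂ)) (c : Fin N → ℂ) :
    ∑ v, c v • vecMulVec (u v) (star (u v))
      = (Matrix.of fun i v => u v i) * Matrix.diagonal c * (Matrix.of fun i v => u v i)ᴴ := by
  ext i j
  rw [Matrix.mul_apply, Matrix.sum_apply]
  refine Finset.sum_congr rfl fun v _ => ?_
  simp [Matrix.mul_diagonal, vecMulVec_apply]
  ring

/-- if `Σ = ∑_v λ̃_v u_v u_v†` is a spectral decomposition of a Hermitian positive
definite `Σ` and `σ² > 0`, then `M̂ = ∑_v max(λ̃_v, σ²) u_v u_v†` belongs to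
`{M Hermitian : M − σ² I ⪰ 0}` and maximizes `g_Σ` over this set. -/
theorem stmt7 {N : ℕ} (σsq : ℝ) (hσ : 0 < σsq)
    (lam : Fin N → ℝ) (u : Fin N → (Fin N → ℂ))
    (hortho : ∀ v w, star (u v) ⬝ᵥ u w = if v = w then 1 else 0)
    (S : Matrix (Fin N) (Fin N) ℂ) (hS : S.PosDef)
    (hdecomp : S = ∑ v, (lam v : ℂ) • vecMulVec (u v) (star (u v))) :
    (((∑ v, ((max (lam v) σsq : ℝ) : ℂ) • vecMulVec (u v) (star (u v))) : Matrix (Fin N) (Fin N) ℂ).IsHermitian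
      ∧ ((∑ v, ((max (lam v) σsq : ℝ) : ℂ) • vecMulVec (u v) (star (u v)))
          - (σsq : ℂ) • (1 : Matrix (Fin N) (Fin N) ℂ)).PosSemidef)
    ∧ ∀ M : Matrix (Fin N) (Fin N) ℂ, M.IsHermitian →
        (M - (σsq : ℂ) • (1 : Matrix (Fin N) (Fin N) ℂ)).PosSemidef →
        gFun S M ≤ gFun S (∑ v, ((max (lam v) σsq : ℝ) : ℂ) • vecMulVec (u v) (star (u v))) := by
  set U : Matrix (Fin N) (Fin N) ℂ := Matrix.of fun i v => u v i with hU
  have h1 : Uᴴ * U = 1 := by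
    ext v w
    rw [Matrix.one_apply, ← hortho v w]
    simp [Matrix.mul_apply, dotProduct, hU]
  have h2 : U * Uᴴ = 1 := mul_eq_one_comm.1 h1
  have hs := sum_eq u (fun v => ((max (lam v) σsq : ℝ) : ℂ))
  have hs' := sum_eq u (fun v => (lam v : ℂ))
  rw [← hU] at hs hs'
  rw [hs] at *
  rw [hs'] at hdecomp
  have hsub : ∀ D : Matrix (Fin N) (Fin N) ℂ, U * D * Uᴴ - (σsq : ℂ) • 1
      = U * (D - (σsq : ℂ) • 1) * Uᴴ := by
    intro D
    rw [Matrix.mul_sub, Matrix.sub_mul]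
    simp [h2]
  refine ⟨⟨?_, ?_⟩, ?_⟩
  · apply Matrix.isHermitian_mul_mul_conjTranspose
    rw [Matrix.IsHermitian, Matrix.diagonal_conjTranspose]
    congr 1; ext v; simp
  · rw [hsub]
    apply Matrix.PosSemidef.mul_mul_conjTranspose_same
    rw [Matrix.smul_one_eq_diagonal, Matrix.diagonal_sub]
    apply Matrix.PosSemidef.diagonal
    intro v
    have : (0 : ℝ) ≤ max (lam v) σsq - σsq := sub_nonneg.2 (le_max_right _ _)
    have h : (0 : ℂ) ≤ ((max (lam v) σsq - σsq : ℝ) : ℂ) := by exact_mod_cast this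
    rw [Complex.ofReal_sub] at h
    exact h
  · intro M _ hM
    have hMU : M = U * (Uᴴ * M * U) * Uᴴ := by
      calc M = (U * Uᴴ) * M * (U * Uᴴ) := by simp [h2]
        _ = _ := by simp only [Matrix.mul_assoc]
    have hW : (Uᴴ * M * U - (σsq : ℂ) • (1 : Matrix (Fin N) (Fin N) ℂ)).PosSemidef := by
      have := hM.conjTranspose_mul_mul_same U
      rw [Matrix.mul_sub, Matrix.sub_mul] at this
      simpa [h1] using this
    rw [hdecomp, hMU, gFun_conj U _ _ h1 h2, gFun_conj U _ _ h1 h2]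
    exact diag_case σsq hσ lam _ hW
end
end

section
/- Let Σ ∈ ℂ^{N×N} be Hermitian positive definite. Then Σ_FB = (Σ + J Σ* J)/2 is Hermitian positive definite and centro-Hermitian, and Σ_FB is the unique maximizer of g_Σ over the set of Hermitian positive definite centro-Hermitian matrices {M ≻ 0 : M = J M* J}. -/
open Matrix
open scoped ComplexOrder

noncomputable section

/-- The `N × N` exchange matrix `J` (ones on the anti-diagonal, zeros elsewhere). -/
def Jex (N : ℕ) : Matrix (Fin N) (Fin N) ℂ :=
  Matrix.of fun i j => if (i : ℕ) + (j : ℕ) = N - 1 then 1 else 0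

/-- `M` is centro-Hermitian: `M = J M* J`, where `M*` is the entrywise complex conjugate. -/
def CentroHermitian {N : ℕ} (M : Matrix (Fin N) (Fin N) ℂ) : Prop :=
  M = Jex N * M.map (starRingEnd ℂ) * Jex N

/-- Forward–backward average `Σ_FB = (Σ + J Σ* J)/2`. -/
def fbAvg {N : ℕ} (S : Matrix (Fin N) (Fin N) ℂ) : Matrix (Fin N) (Fin N) ℂ :=
  (1 / 2 : ℂ) • (S + Jex N * S.map (starRingEnd ℂ) * Jex N)

lemma Jex_mul_self (N : ℕ) : Jex N * Jex N = 1 := by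
  ext i j
  rw [Matrix.mul_apply, Finset.sum_eq_single (Fin.rev i)]
  · simp only [Jex, Matrix.of_apply, Fin.val_rev, Matrix.one_apply, Fin.ext_iff]
    have h1 : (i : ℕ) + (N - (i + 1)) = N - 1 := by omega
    rw [if_pos h1, one_mul]
    congr 1
    apply propext
    constructor <;> intro h <;> omega
  · intro b _ hb
    have : ¬ ((i : ℕ) + (b : ℕ) = N - 1) := by
      intro h
      apply hb
      ext
      simp only [Fin.val_rev]
      omega
    simp [Jex, this]
  · simp

lemma Jex_transpose (N : ℕ) : (Jex N)ᵀ = Jex N := by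
  ext i j
  simp [Jex, add_comm]

lemma Jex_conjTranspose (N : ℕ) : (Jex N)ᴴ = Jex N := by
  ext i j
  simp only [Jex, conjTranspose_apply, of_apply, add_comm]
  split_ifs <;> simp

lemma Jex_inv (N : ℕ) : (Jex N)⁻¹ = Jex N := Matrix.inv_eq_left_inv (Jex_mul_self N)

lemma map_conj_of_herm {N : ℕ} {S : Matrix (Fin N) (Fin N) ℂ} (h : S.IsHermitian) :
    S.map (starRingEnd ℂ) = Sᵀ := by
  ext i j
  simpa using h.apply j i

lemma conjJ {N : ℕ} (A : Matrix (Fin N) (Fin N) ℂ) : Jex N * (Jex N * A * Jex N) * Jex N = A := by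
  have := Jex_mul_self N
  calc _ = (Jex N * Jex N) * A * (Jex N * Jex N) := by simp only [Matrix.mul_assoc]
    _ = A := by rw [this]; simp

lemma fbAvg_eq {N : ℕ} {S : Matrix (Fin N) (Fin N) ℂ} (h : S.IsHermitian) :
    fbAvg S = (1 / 2 : ℂ) • (S + Jex N * Sᵀ * Jex N) := by
  rw [fbAvg, map_conj_of_herm h]

lemma fbAvg_posDef {N : ℕ} {S : Matrix (Fin N) (Fin N) ℂ} (h : S.PosDef) : (fbAvg S).PosDef := by
  rw [fbAvg_eq h.1]
  have h2 : (Jex N * Sᵀ * Jex N).PosSemidef := by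
    have := h.transpose.posSemidef.mul_mul_conjTranspose_same (Jex N)
    rwa [Jex_conjTranspose] at this
  refine (h.add_posSemidef h2).smul ?_
  simp

lemma fbAvg_centro {N : ℕ} {S : Matrix (Fin N) (Fin N) ℂ} (h : S.PosDef) :
    CentroHermitian (fbAvg S) := by
  rw [CentroHermitian, map_conj_of_herm (fbAvg_posDef h).1, fbAvg_eq h.1]
  simp only [transpose_smul, transpose_add, transpose_mul, transpose_transpose, Jex_transpose,
    Matrix.mul_smul, Matrix.smul_mul, Matrix.mul_add, Matrix.add_mul]
  rw [← Matrix.mul_assoc (Jex N) S, conjJ, add_comm]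

lemma trace_fb {N : ℕ} {S M : Matrix (Fin N) (Fin N) ℂ} (h : S.PosDef) (hM : M.PosDef)
    (hc : CentroHermitian M) : (M⁻¹ * fbAvg S).trace = (M⁻¹ * S).trace := by
  rw [CentroHermitian, map_conj_of_herm hM.1] at hc
  have hi : M⁻¹ = Jex N * (M⁻¹)ᵀ * Jex N := by
    conv_lhs => rw [hc]
    rw [Matrix.mul_inv_rev, Matrix.mul_inv_rev, Jex_inv, transpose_nonsing_inv, Matrix.mul_assoc]
  have key : (M⁻¹ * (Jex N * Sᵀ * Jex N)).trace = (M⁻¹ * S).trace := by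
    calc _ = ((Jex N * M⁻¹ * Jex N) * Sᵀ).trace := by
          rw [← Matrix.mul_assoc, Matrix.trace_mul_comm]
          simp only [Matrix.mul_assoc]
      _ = ((M⁻¹)ᵀ * Sᵀ).trace := by
          conv_lhs => rw [hi]
          rw [conjJ]
      _ = _ := by rw [← transpose_mul, trace_transpose, Matrix.trace_mul_comm]
  rw [fbAvg_eq h.1, Matrix.mul_smul, Matrix.mul_add, trace_smul, trace_add, key, smul_eq_mul]
  ring

lemma logdet {N : ℕ} {A : Matrix (Fin N) (Fin N) ℂ} (h : A.PosDef) :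
    Real.log A.det.re ≤ A.trace.re - N ∧ (Real.log A.det.re = A.trace.re - N → A = 1) := by
  have hd : A.det.re = ∏ i, h.1.eigenvalues i := by
    rw [h.1.det_eq_prod_eigenvalues]
    have : (∏ i, (h.1.eigenvalues i : ℂ)) = ((∏ i, h.1.eigenvalues i : ℝ) : ℂ) := by push_cast; rfl
    exact (congrArg Complex.re this).trans (Complex.ofReal_re _)
  have ht : A.trace.re - N = ∑ i, (h.1.eigenvalues i - 1) := by
    rw [h.1.trace_eq_sum_eigenvalues]
    simp
  have hl : Real.log A.det.re = ∑ i, Real.log (h.1.eigenvalues i) := by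
    rw [hd, Real.log_prod (fun i _ => (h.eigenvalues_pos i).ne')]
  have hle : ∀ i ∈ Finset.univ, Real.log (h.1.eigenvalues i) ≤ h.1.eigenvalues i - 1 :=
    fun i _ => Real.log_le_sub_one_of_pos (h.eigenvalues_pos i)
  rw [hl, ht]
  refine ⟨Finset.sum_le_sum hle, fun he => ?_⟩
  rw [Finset.sum_eq_sum_iff_of_le hle] at he
  have h1 : h.1.eigenvalues = fun _ => 1 := by
    funext i
    by_contra hne
    exact (Real.log_lt_sub_one_of_pos (h.eigenvalues_pos i) hne).ne (he i (Finset.mem_univ i))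
  have hs := h.1.spectral_theorem
  rw [hs, h1]
  have : diagonal (RCLike.ofReal ∘ fun _ : Fin N => (1:ℝ)) = (1 : Matrix (Fin N) (Fin N) ℂ) := by
    ext i j
    simp [Matrix.diagonal, Matrix.one_apply]
  rw [this, map_one]

open scoped MatrixOrder Matrix.Norms.L2Operator in
lemma exists_factor {N : ℕ} {A : Matrix (Fin N) (Fin N) ℂ} (h : A.PosDef) :
    ∃ B : Matrix (Fin N) (Fin N) ℂ, IsUnit B ∧ A = Bᴴ * B := by
  obtain ⟨y, hy, e⟩ := CStarAlgebra.isStrictlyPositive_iff_eq_star_mul_self.mp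
    h.isStrictlyPositive
  exact ⟨y, hy, e⟩

lemma gFun_max {N : ℕ} {F M : Matrix (Fin N) (Fin N) ℂ} (hF : F.PosDef) (hM : M.PosDef) :
    gFun F M ≤ gFun F F ∧ (gFun F M = gFun F F → M = F) := by
  obtain ⟨B, hB, e⟩ := exists_factor hM.inv
  have hA : (B * F * Bᴴ).PosDef := (IsUnit.posDef_star_right_conjugate_iff hB).2 hF
  have ht : (B * F * Bᴴ).trace = (M⁻¹ * F).trace := by
    rw [e, Matrix.trace_mul_comm, Matrix.mul_assoc]
  have hMp := Complex.pos_iff.1 hM.det_pos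
  have hFp := Complex.pos_iff.1 hF.det_pos
  have hAp := Complex.pos_iff.1 hA.det_pos
  have hMu : IsUnit M.det := hM.det_pos.ne'.isUnit
  have hFu : IsUnit F.det := hF.det_pos.ne'.isUnit
  have hd : M.det * (B * F * Bᴴ).det = F.det := by
    have h1 : (B * F * Bᴴ).det = (M⁻¹).det * F.det := by
      rw [e]; simp only [det_mul]; ring
    rw [h1, ← mul_assoc, ← det_mul, mul_nonsing_inv _ hMu, det_one, one_mul]
  have hdr : M.det.re * (B * F * Bᴴ).det.re = F.det.re := by
    rw [← hd, Complex.mul_re, ← hMp.2]; simp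
  have hlog : Real.log F.det.re = Real.log M.det.re + Real.log (B * F * Bᴴ).det.re := by
    rw [← hdr, Real.log_mul hMp.1.ne' hAp.1.ne']
  have hFF : ((F⁻¹ * F).trace).re = N := by
    rw [nonsing_inv_mul _ hFu]; simp
  obtain ⟨l1, l2⟩ := logdet hA
  rw [ht] at l1 l2
  simp only [gFun, hFF, hlog]
  refine ⟨by linarith, fun he => ?_⟩
  have h1 := l2 (by linarith)
  have h2 : F * M⁻¹ = 1 := by
    rw [e]
    have h3 : B * (F * Bᴴ) = 1 := by rw [← Matrix.mul_assoc, h1]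
    have h4 := mul_eq_one_comm.1 h3
    rw [← Matrix.mul_assoc, h4]
  calc M = F * M⁻¹ * M := by rw [h2, one_mul]
    _ = F := by rw [Matrix.mul_assoc, nonsing_inv_mul _ hMu, mul_one]

/-- for Hermitian positive definite `Σ`, the forward–backward average
`Σ_FB = (Σ + J Σ* J)/2` is Hermitian positive definite and centro-Hermitian, and it is the
unique maximizer of `g_Σ` over the Hermitian positive definite centro-Hermitian matrices. -/
theorem stmt8 {N : ℕ} (S : Matrix (Fin N) (Fin N) ℂ) (hS : S.PosDef) :
    (fbAvg S).PosDef ∧ CentroHermitian (fbAvg S) ∧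
    ∀ M : Matrix (Fin N) (Fin N) ℂ, M.PosDef → CentroHermitian M →
      gFun S M ≤ gFun S (fbAvg S) ∧ (gFun S M = gFun S (fbAvg S) → M = fbAvg S) := by
  have hF := fbAvg_posDef hS
  have hC := fbAvg_centro hS
  refine ⟨hF, hC, fun M hM hMc => ?_⟩
  have e1 : gFun S M = gFun (fbAvg S) M := by
    simp only [gFun, trace_fb hS hM hMc]
  have e2 : gFun S (fbAvg S) = gFun (fbAvg S) (fbAvg S) := by
    simp only [gFun, trace_fb hS hF hC]
  rw [e1, e2]
  exact gFun_max hF hM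
end
end

section
/- Let Σ ∈ ℂ^{N×N} be Hermitian positive definite with eigenvalues λ̃_1 ≥ λ̃_2 ≥ … ≥ λ̃_N and corresponding orthonormal eigenvectors u_1,…,u_N, and let d be an integer with 0 ≤ d < N. Set σ̃² = (1/(N−d)) ∑_{v=d+1}^N λ̃_v. Then the matrix M̂ = ∑_{v=1}^d (λ̃_v − σ̃²) u_v u_v† + σ̃² I belongs to the set C_d = {σ_n² I + P : σ_n² > 0, P ∈ ℂ^{N×N} Hermitian positive semidefinite with rank(P) ≤ d} and maximizes g_Σ over C_d. -/
open Matrix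
open scoped ComplexOrder

noncomputable section

/-- The constraint set `C_d = {σ_n² I + P : σ_n² > 0, P ⪰ 0 Hermitian, rank(P) ≤ d}`. -/
def rankConstrainedSet (N d : ℕ) : Set (Matrix (Fin N) (Fin N) ℂ) :=
  {M | ∃ σn : ℝ, 0 < σn ∧ ∃ P : Matrix (Fin N) (Fin N) ℂ,
    P.PosSemidef ∧ P.rank ≤ d ∧ M = (σn : ℂ) • (1 : Matrix (Fin N) (Fin N) ℂ) + P}

lemma aux_ds {N : ℕ} (a b : Fin N → ℝ) (hab : Antivary a b) (B : Matrix (Fin N) (Fin N) ℝ)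
    (hB : B ∈ doublyStochastic ℝ (Fin N)) :
    ∑ i, a i * b i ≤ ∑ i, ∑ j, B i j * (a i * b j) := by
  obtain ⟨w, hw0, hw1, hw⟩ := exists_eq_sum_perm_of_mem_doublyStochastic hB
  have h1 : ∑ i, ∑ j, B i j * (a i * b j) = ∑ τ, w τ * ∑ i, a i * b (τ i) := by
    rw [← hw]
    simp only [Matrix.sum_apply, Matrix.smul_apply, smul_eq_mul, Finset.sum_mul, Finset.mul_sum]
    rw [Finset.sum_congr rfl (fun i _ => Finset.sum_comm), Finset.sum_comm]
    refine Finset.sum_congr rfl fun τ _ => Finset.sum_congr rfl fun i _ => ?_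
    rw [Finset.sum_eq_single (τ i)]
    · simp [Equiv.Perm.permMatrix, PEquiv.toMatrix_apply]
    · intro j _ hj
      simp [Equiv.Perm.permMatrix, PEquiv.toMatrix_apply, hj.symm]
    · simp
  rw [h1]
  calc ∑ i, a i * b i = ∑ τ, w τ * ∑ i, a i * b i := by rw [← Finset.sum_mul, hw1, one_mul]
    _ ≤ _ := Finset.sum_le_sum fun τ _ =>
      mul_le_mul_of_nonneg_left hab.sum_mul_le_sum_mul_comp_perm (hw0 τ)

lemma aux_decomp {N : ℕ} (u : Fin N → (Fin N → ℂ)) (c : Fin N → ℝ) :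
    ∑ v, (c v : ℂ) • vecMulVec (u v) (star (u v)) =
      (Matrix.of fun i j => u j i) * diagonal (fun i => (c i : ℂ)) *
        (Matrix.of fun i j => u j i)ᴴ := by
  ext i j
  simp only [Matrix.sum_apply, Matrix.smul_apply, vecMulVec_apply, Matrix.mul_apply (M := _ * _),
    Matrix.mul_diagonal, Matrix.of_apply, conjTranspose_apply, smul_eq_mul, Pi.star_apply]
  exact Finset.sum_congr rfl fun v _ => by ring

lemma aux_ds_mem {N : ℕ} (W : Matrix (Fin N) (Fin N) ℂ) (hW : W * Wᴴ = 1) :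
    (Matrix.of fun i j => Complex.normSq (W i j)) ∈ doublyStochastic ℝ (Fin N) := by
  have hW' : Wᴴ * W = 1 := mul_eq_one_comm.mp hW
  rw [mem_doublyStochastic_iff_sum]
  refine ⟨fun i j => Complex.normSq_nonneg _, fun i => ?_, fun j => ?_⟩
  · have := congrFun (congrFun hW i) i
    simp only [Matrix.mul_apply, conjTranspose_apply, one_apply_eq, RCLike.star_def,
      Complex.mul_conj] at this
    exact_mod_cast this
  · have := congrFun (congrFun hW' j) j
    simp only [Matrix.mul_apply, conjTranspose_apply, one_apply_eq, RCLike.star_def,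
      ← Complex.normSq_eq_conj_mul_self] at this
    exact_mod_cast this

lemma aux_g_s10 {N : ℕ} (U V : Matrix (Fin N) (Fin N) ℂ) (hU : Uᴴ * U = 1)
    (m l : Fin N → ℝ) (hm : ∀ i, 0 < m i) :
    gFun (V * diagonal (fun i => (l i : ℂ)) * Vᴴ) (U * diagonal (fun i => (m i : ℂ)) * Uᴴ) =
      - ∑ i, Real.log (m i)
        - ∑ i, ∑ j, Complex.normSq ((Uᴴ * V) i j) * ((m i)⁻¹ * l j) := by
  have hU' : U * Uᴴ = 1 := mul_eq_one_comm.mp hU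
  have hdet : (U * diagonal (fun i => (m i : ℂ)) * Uᴴ).det = ((∏ i, m i : ℝ) : ℂ) := by
    rw [Matrix.det_mul, Matrix.det_mul, mul_right_comm, ← Matrix.det_mul, hU']
    simp
  have hinv : (U * diagonal (fun i => (m i : ℂ)) * Uᴴ)⁻¹ =
      U * diagonal (fun i => (((m i)⁻¹ : ℝ) : ℂ)) * Uᴴ := by
    apply Matrix.inv_eq_right_inv
    calc _ = U * (diagonal (fun i => (m i : ℂ)) * (Uᴴ * U) *
        diagonal (fun i => (((m i)⁻¹ : ℝ) : ℂ))) * Uᴴ := by simp only [Matrix.mul_assoc]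
      _ = U * 1 * Uᴴ := by
        rw [hU, Matrix.mul_one, Matrix.diagonal_mul_diagonal]
        congr 2
        rw [← Matrix.diagonal_one]
        congr 1
        ext i
        have := (hm i).ne'
        push_cast
        exact mul_inv_cancel₀ (by exact_mod_cast this)
      _ = 1 := by rw [Matrix.mul_one, hU']
  have htr : ((U * diagonal (fun i => (((m i)⁻¹ : ℝ) : ℂ)) * Uᴴ) *
      (V * diagonal (fun i => (l i : ℂ)) * Vᴴ)).trace =
      ((∑ i, ∑ j, Complex.normSq ((Uᴴ * V) i j) * ((m i)⁻¹ * l j) : ℝ) : ℂ) := by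
    calc _ = (U * (diagonal (fun i => (((m i)⁻¹ : ℝ) : ℂ)) * Uᴴ *
      (V * diagonal (fun i => (l i : ℂ)) * Vᴴ))).trace := by simp only [Matrix.mul_assoc]
      _ = ((diagonal (fun i => (((m i)⁻¹ : ℝ) : ℂ)) * (Uᴴ * V)) *
          (diagonal (fun i => (l i : ℂ)) * (Uᴴ * V)ᴴ)).trace := by
        rw [Matrix.trace_mul_comm, conjTranspose_mul, conjTranspose_conjTranspose]
        simp only [Matrix.mul_assoc]
      _ = _ := by
        rw [Matrix.trace]
        push_cast
        refine Finset.sum_congr rfl fun i _ => ?_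
        rw [Matrix.diag_apply, Matrix.mul_apply]
        refine Finset.sum_congr rfl fun j _ => ?_
        rw [Matrix.diagonal_mul, Matrix.diagonal_mul, conjTranspose_apply, RCLike.star_def,
          ← Complex.mul_conj]
        push_cast
        ring
  rw [gFun, hinv, htr, hdet, Complex.ofReal_re, Complex.ofReal_re,
    Real.log_prod (fun i _ => (hm i).ne')]

lemma aux_sorted {N d : ℕ} (P : Matrix (Fin N) (Fin N) ℂ) (hP : P.PosSemidef)
    (hr : P.rank ≤ d) :
    ∃ (U : Matrix (Fin N) (Fin N) ℂ) (p : Fin N → ℝ), Uᴴ * U = 1 ∧ Antitone p ∧ (∀ i, 0 ≤ p i) ∧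
      (∀ i : Fin N, d ≤ (i : ℕ) → p i = 0) ∧ P = U * diagonal (fun i => (p i : ℂ)) * Uᴴ := by
  have hH := hP.isHermitian
  set U₀ : Matrix (Fin N) (Fin N) ℂ := hH.eigenvectorUnitary.1 with hU₀
  have hU : U₀ᴴ * U₀ = 1 := Unitary.coe_star_mul_self hH.eigenvectorUnitary
  have hPd : P = U₀ * diagonal (fun i => (hH.eigenvalues i : ℂ)) * U₀ᴴ := by
    conv_lhs => rw [hH.spectral_theorem, Unitary.conjStarAlgAut_apply]
    rfl
  set ρ := Tuple.sort (fun i => - hH.eigenvalues i)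
  have hanti : Antitone (hH.eigenvalues ∘ ρ) := by
    intro i j hij
    have := Tuple.monotone_sort (fun i => - hH.eigenvalues i) hij
    simpa using this
  refine ⟨U₀.submatrix id ρ, hH.eigenvalues ∘ ρ, ?_, hanti,
    fun i => hP.eigenvalues_nonneg _, ?_, ?_⟩
  · rw [conjTranspose_submatrix, ← Matrix.submatrix_mul _ _ _ _ _ Function.bijective_id, hU]
    simp
  · intro i hi
    by_contra hne
    have hpos : 0 < (hH.eigenvalues ∘ ρ) i := lt_of_le_of_ne (hP.eigenvalues_nonneg _) (Ne.symm hne)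
    rw [hH.rank_eq_card_non_zero_eigs, Fintype.card_subtype] at hr
    have hsub : (Finset.Iic i).map ρ.toEmbedding ⊆
        Finset.univ.filter (fun i => hH.eigenvalues i ≠ 0) := by
      intro x hx
      obtain ⟨j, hj, rfl⟩ := Finset.mem_map.mp hx
      simp only [Finset.mem_filter, Finset.mem_univ, true_and]
      exact (lt_of_lt_of_le hpos (hanti (Finset.mem_Iic.mp hj))).ne'
    have := Finset.card_le_card hsub
    rw [Finset.card_map, Fin.card_Iic] at this
    omega
  · conv_lhs => rw [hPd]
    ext i j
    simp only [Matrix.mul_apply (M := _ * _), Matrix.mul_diagonal, conjTranspose_apply,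
      Matrix.submatrix_apply, id, Function.comp]
    exact (Equiv.sum_comp ρ (fun x => U₀ i x * (hH.eigenvalues x : ℂ) * star (U₀ j x))).symm

lemma aux_log_s10 (m μ : ℝ) (hm : 0 < m) (hμ : 0 < μ) :
    Real.log μ + 1 ≤ Real.log m + m⁻¹ * μ := by
  have h := Real.log_le_sub_one_of_pos (mul_pos (inv_pos.mpr hm) hμ)
  rw [Real.log_mul (inv_pos.mpr hm).ne' hμ.ne', Real.log_inv] at h
  linarith

lemma aux_card {N d : ℕ} (hd : d < N) :
    ((Finset.univ.filter (fun w : Fin N => d ≤ (w : ℕ))).card : ℝ) = (N : ℝ) - d := by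
  have : Finset.univ.filter (fun w : Fin N => d ≤ (w : ℕ)) = Finset.Ici ⟨d, hd⟩ := by
    ext w; simp [Fin.le_def]
  rw [this, Fin.card_Ici, Nat.cast_sub hd.le]

lemma aux_cardlt {N d : ℕ} (hd : d < N) :
    (Finset.univ.filter (fun w : Fin N => (w : ℕ) < d)).card = d := by
  have : Finset.univ.filter (fun w : Fin N => (w : ℕ) < d) = Finset.Iio ⟨d, hd⟩ := by
    ext w; simp [Fin.lt_def]
  rw [this, Fin.card_Iio]

/-- let `Σ = ∑_v λ̃_v u_v u_v†` be a spectral decomposition of a Hermitian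
positive definite `Σ` with eigenvalues arranged in decreasing order, let `0 ≤ d < N`, and set
`σ̃² = (1/(N−d)) ∑_{v>d} λ̃_v`.  Then
`M̂ = ∑_{v≤d} (λ̃_v − σ̃²) u_v u_v† + σ̃² I` belongs to `C_d` and maximizes `g_Σ` over `C_d`. -/
theorem stmt10 {N d : ℕ} (hd : d < N)
    (lam : Fin N → ℝ) (hdec : ∀ i j : Fin N, i ≤ j → lam j ≤ lam i)
    (u : Fin N → (Fin N → ℂ))
    (hortho : ∀ v w, star (u v) ⬝ᵥ u w = if v = w then 1 else 0)
    (S : Matrix (Fin N) (Fin N) ℂ) (hS : S.PosDef)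
    (hdecomp : S = ∑ v, (lam v : ℂ) • vecMulVec (u v) (star (u v))) :
    (((∑ v ∈ Finset.univ.filter (fun v : Fin N => (v : ℕ) < d),
        ((lam v - (∑ w ∈ Finset.univ.filter (fun w : Fin N => d ≤ (w : ℕ)), lam w)
            / ((N : ℝ) - d) : ℝ) : ℂ) • vecMulVec (u v) (star (u v)))
      + (((∑ w ∈ Finset.univ.filter (fun w : Fin N => d ≤ (w : ℕ)), lam w)
            / ((N : ℝ) - d) : ℝ) : ℂ) • (1 : Matrix (Fin N) (Fin N) ℂ))
      ∈ rankConstrainedSet N d)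
    ∧ ∀ M ∈ rankConstrainedSet N d,
        gFun S M ≤ gFun S
          ((∑ v ∈ Finset.univ.filter (fun v : Fin N => (v : ℕ) < d),
            ((lam v - (∑ w ∈ Finset.univ.filter (fun w : Fin N => d ≤ (w : ℕ)), lam w)
                / ((N : ℝ) - d) : ℝ) : ℂ) • vecMulVec (u v) (star (u v)))
          + (((∑ w ∈ Finset.univ.filter (fun w : Fin N => d ≤ (w : ℕ)), lam w)
                / ((N : ℝ) - d) : ℝ) : ℂ) • (1 : Matrix (Fin N) (Fin N) ℂ)) := by
  set s : ℝ := (∑ w ∈ Finset.univ.filter (fun w : Fin N => d ≤ (w : ℕ)), lam w)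
    / ((N : ℝ) - d) with hs
  have hNd : (0 : ℝ) < (N : ℝ) - d := sub_pos.mpr (by exact_mod_cast hd)
  have hsum : ∑ w ∈ Finset.univ.filter (fun w : Fin N => d ≤ (w : ℕ)), lam w
      = ((N : ℝ) - d) * s := by rw [hs]; field_simp
  set V : Matrix (Fin N) (Fin N) ℂ := Matrix.of fun i j => u j i with hV
  have hVV : Vᴴ * V = 1 := by
    ext i j
    rw [Matrix.mul_apply, Matrix.one_apply, ← hortho i j]
    rfl
  have hVV' : V * Vᴴ = 1 := mul_eq_one_comm.mp hVV
  rw [aux_decomp] at hdecomp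
  -- positivity of the eigenvalues
  have hlam : ∀ v, 0 < lam v := by
    have h1 : (Vᴴ * S * V).PosDef := by
      refine hS.conjTranspose_mul_mul_same ?_
      intro x y hxy
      have := congrArg (Vᴴ *ᵥ ·) hxy
      simpa [Matrix.mulVec_mulVec, hVV] using this
    have h2 : Vᴴ * S * V = diagonal (fun i => (lam i : ℂ)) := by
      rw [hdecomp]
      calc _ = (Vᴴ * V) * diagonal (fun i => (lam i : ℂ)) * (Vᴴ * V) := by
            simp only [Matrix.mul_assoc, hV]
        _ = _ := by rw [hVV, Matrix.one_mul, Matrix.mul_one]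
    rw [h2, Matrix.posDef_diagonal_iff] at h1
    intro v
    exact_mod_cast h1 v
  have hspos : 0 < s := by
    refine div_pos (Finset.sum_pos (fun i _ => hlam i) ⟨⟨d, hd⟩, by simp⟩) hNd
  have hsle : ∀ v : Fin N, (v : ℕ) < d → s ≤ lam v := by
    intro v hv
    rw [hs, div_le_iff₀ hNd, ← aux_card hd, mul_comm, ← nsmul_eq_mul]
    refine Finset.sum_le_card_nsmul _ _ _ fun w hw => hdec v w ?_
    have := (Finset.mem_filter.mp hw).2
    exact Fin.le_def.mpr (by omega)
  set c : Fin N → ℝ := fun v => if (v : ℕ) < d then lam v - s else 0 with hc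
  have hc0 : ∀ v, 0 ≤ c v := by
    intro v
    simp only [hc]
    split_ifs with h
    · linarith [hsle v h]
    · exact le_rfl
  have hQ : (∑ v ∈ Finset.univ.filter (fun v : Fin N => (v : ℕ) < d),
        ((lam v - s : ℝ) : ℂ) • vecMulVec (u v) (star (u v))) =
      V * diagonal (fun i => (c i : ℂ)) * Vᴴ := by
    rw [hV, ← aux_decomp, Finset.sum_filter]
    refine Finset.sum_congr rfl fun v _ => ?_
    simp only [hc]
    split_ifs <;> simp
  have hadd : ∀ (U : Matrix (Fin N) (Fin N) ℂ) (hU : U * Uᴴ = 1) (t : ℝ) (p : Fin N → ℝ),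
      U * diagonal (fun i => (p i : ℂ)) * Uᴴ + (t : ℂ) • (1 : Matrix (Fin N) (Fin N) ℂ) =
      U * diagonal (fun i => ((p i + t : ℝ) : ℂ)) * Uᴴ := by
    intro U hU t p
    have : diagonal (fun i => ((p i + t : ℝ) : ℂ)) = diagonal (fun i => (p i : ℂ)) +
        (t : ℂ) • (1 : Matrix (Fin N) (Fin N) ℂ) := by
      rw [← Matrix.diagonal_one, ← Matrix.diagonal_smul, Matrix.diagonal_add]
      congr 1
      ext i
      simp
    rw [this, Matrix.mul_add, Matrix.add_mul, Matrix.mul_smul, Matrix.smul_mul, Matrix.mul_one, hU]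
  rw [hQ]
  constructor
  · refine ⟨s, hspos, V * diagonal (fun i => (c i : ℂ)) * Vᴴ, ?_, ?_, add_comm _ _⟩
    · refine Matrix.PosSemidef.mul_mul_conjTranspose_same ?_ V
      rw [Matrix.posSemidef_diagonal_iff]
      intro i
      exact_mod_cast hc0 i
    · refine (Matrix.rank_mul_le_left _ _).trans ((Matrix.rank_mul_le_right _ _).trans ?_)
      rw [Matrix.rank_diagonal, Fintype.card_subtype]
      refine (Finset.card_le_card ?_).trans (aux_cardlt hd).le
      intro i hi
      simp only [Finset.mem_filter, Finset.mem_univ, true_and, hc] at hi ⊢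
      by_contra h
      simp [h] at hi
  · rintro M ⟨t, ht, P, hP, hr, rfl⟩
    obtain ⟨U, p, hU, hanti, hp0, hpz, rfl⟩ := aux_sorted P hP hr
    have hU' : U * Uᴴ = 1 := mul_eq_one_comm.mp hU
    rw [add_comm ((t : ℂ) • (1 : Matrix (Fin N) (Fin N) ℂ)), hadd U hU', hadd V hVV', hdecomp]
    have hm : ∀ i, 0 < p i + t := fun i => by linarith [hp0 i]
    have hμ : ∀ i, 0 < c i + s := fun i => by linarith [hc0 i]
    rw [aux_g_s10 U _ hU _ _ hm, aux_g_s10 V _ hVV _ _ hμ]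
    have hB := aux_ds (fun i => (p i + t)⁻¹) lam (by
        intro i j hij
        have hji : j ≤ i := by
          by_contra h
          exact absurd (hdec i j (not_le.mp h).le) (not_le.mpr hij)
        exact inv_anti₀ (hm i) (by linarith [hanti hji])) _ (aux_ds_mem (Uᴴ * V) (by
        rw [conjTranspose_mul, conjTranspose_conjTranspose]
        calc _ = Uᴴ * (V * Vᴴ) * U := by simp only [Matrix.mul_assoc]
          _ = 1 := by rw [hVV', Matrix.mul_one, hU]))
    simp only [Matrix.of_apply] at hB
    have hid : ∑ i, ∑ j, Complex.normSq ((Vᴴ * V) i j) * ((c i + s)⁻¹ * lam j) =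
        ∑ i, (c i + s)⁻¹ * lam i := by
      rw [hVV]
      refine Finset.sum_congr rfl fun i _ => ?_
      rw [Finset.sum_eq_single i]
      · simp
      · intro j _ hj
        simp [Matrix.one_apply_ne hj.symm]
      · simp
    have key : ∀ (a : Fin N → ℝ) (k : ℝ), (∀ i : Fin N, d ≤ (i : ℕ) → a i = k) →
        ∑ i, a i * lam i = ∑ i, a i * (c i + s) := by
      intro a k ha
      rw [← Finset.sum_filter_add_sum_filter_not Finset.univ (fun v : Fin N => (v : ℕ) < d),
        ← Finset.sum_filter_add_sum_filter_not Finset.univ (fun v : Fin N => (v : ℕ) < d)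
          (fun i => a i * (c i + s))]
      simp only [not_lt]
      congr 1
      · refine Finset.sum_congr rfl fun i hi => ?_
        simp [hc, (Finset.mem_filter.mp hi).2]
      · have e1 : ∑ i ∈ Finset.univ.filter (fun w : Fin N => d ≤ (w : ℕ)), a i * lam i =
            ∑ i ∈ Finset.univ.filter (fun w : Fin N => d ≤ (w : ℕ)), k * lam i :=
          Finset.sum_congr rfl fun i hi => by rw [ha i (Finset.mem_filter.mp hi).2]
        have e2 : ∑ i ∈ Finset.univ.filter (fun w : Fin N => d ≤ (w : ℕ)), a i * (c i + s) =
            ∑ i ∈ Finset.univ.filter (fun w : Fin N => d ≤ (w : ℕ)), k * s :=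
          Finset.sum_congr rfl fun i hi => by
            have h := (Finset.mem_filter.mp hi).2
            rw [ha i h]
            simp [hc, not_lt.mpr h]
        rw [e1, e2, ← Finset.mul_sum, hsum, Finset.sum_const, nsmul_eq_mul, aux_card hd]
        ring
    have k1 := key (fun i => (p i + t)⁻¹) t⁻¹ (fun i hi => by simp [hpz i hi])
    have k2 := key (fun i => (c i + s)⁻¹) s⁻¹ (fun i hi => by simp [hc, not_lt.mpr hi])
    have k3 : ∑ i, (c i + s)⁻¹ * (c i + s) = ∑ i : Fin N, (1 : ℝ) :=
      Finset.sum_congr rfl fun i _ => inv_mul_cancel₀ (hμ i).ne'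
    have hfin := Finset.sum_le_sum fun i (_ : i ∈ Finset.univ) =>
      aux_log_s10 (p i + t) (c i + s) (hm i) (hμ i)
    rw [Finset.sum_add_distrib, Finset.sum_add_distrib] at hfin
    rw [hid]
    linarith
end
end

section
/- Let A ∈ ℂ^{p×N} be a selection matrix (1 ≤ p ≤ N) with complementary selection matrix Ā, let y ∈ ℂ^p, and let M, M₁ ∈ ℂ^{N×N} be Hermitian positive definite. Setting C₁ = C(M₁, A, y), the following minorization (Gibbs/Jensen) inequality holds: ln det(A M A†) + y† (A M A†)^{−1} y − ln det(A M₁ A†) − y† (A M₁ A†)^{−1} y ≤ ln det M + tr(M^{−1} C₁) − ln det M₁ − tr(M₁^{−1} C₁). -/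
open Matrix
open scoped ComplexOrder

noncomputable section

/-- `A` is a selection matrix and `B` is its complementary selection matrix, whose rows are
the remaining `N - p` rows of the identity matrix. -/
def IsComplementarySelectionPair {p N : ℕ} (A : Matrix (Fin p) (Fin N) ℂ)
    (B : Matrix (Fin (N - p)) (Fin N) ℂ) : Prop :=
  ∃ (f : Fin p → Fin N) (g : Fin (N - p) → Fin N),
    Function.Injective f ∧ Function.Injective g ∧
    Set.range g = (Set.range f)ᶜ ∧
    (∀ i j, A i j = if j = f i then 1 else 0) ∧
    (∀ i j, B i j = if j = g i then 1 else 0)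

/-- `μ(M, A, y) = Ā M A† (A M A†)⁻¹ y`. -/
def muVec {p N : ℕ} (M : Matrix (Fin N) (Fin N) ℂ) (A : Matrix (Fin p) (Fin N) ℂ)
    (B : Matrix (Fin (N - p)) (Fin N) ℂ) (y : Fin p → ℂ) : Fin (N - p) → ℂ :=
  (B * M * Aᴴ * (A * M * Aᴴ)⁻¹) *ᵥ y

/-- `G(M, A) = Ā M Ā† − Ā M A† (A M A†)⁻¹ A M Ā†`. -/
def Gmat {p N : ℕ} (M : Matrix (Fin N) (Fin N) ℂ) (A : Matrix (Fin p) (Fin N) ℂ)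
    (B : Matrix (Fin (N - p)) (Fin N) ℂ) : Matrix (Fin (N - p)) (Fin (N - p)) ℂ :=
  B * M * Bᴴ - B * M * Aᴴ * (A * M * Aᴴ)⁻¹ * (A * M * Bᴴ)

/-- Conditional correlation matrix
`C(M, A, y) = (A† y + Ā† μ)(A† y + Ā† μ)† + Ā† G(M, A) Ā`. -/
def Cmat {p N : ℕ} (M : Matrix (Fin N) (Fin N) ℂ) (A : Matrix (Fin p) (Fin N) ℂ)
    (B : Matrix (Fin (N - p)) (Fin N) ℂ) (y : Fin p → ℂ) : Matrix (Fin N) (Fin N) ℂ :=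
  vecMulVec (Aᴴ *ᵥ y + Bᴴ *ᵥ muVec M A B y) (star (Aᴴ *ᵥ y + Bᴴ *ᵥ muVec M A B y))
    + Bᴴ * Gmat M A B * B

open scoped MatrixOrder Matrix.Norms.L2Operator in
lemma exists_factor_aux {n : ℕ} {P : Matrix (Fin n) (Fin n) ℂ} (hP : P.PosDef) :
    ∃ L : Matrix (Fin n) (Fin n) ℂ, IsUnit L ∧ P = Lᴴ * L := by
  obtain ⟨b, hb, h⟩ := CStarAlgebra.isStrictlyPositive_iff_eq_star_mul_self.mp
    hP.isStrictlyPositive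
  exact ⟨b, hb, h⟩

lemma log_det_le_aux {n : ℕ} {X : Matrix (Fin n) (Fin n) ℂ} (hX : X.PosDef) :
    Real.log X.det.re ≤ X.trace.re - n := by
  have hd : X.det.re = ∏ i, hX.1.eigenvalues i := by
    rw [hX.1.det_eq_prod_eigenvalues]
    simp only [Complex.coe_algebraMap, ← Complex.ofReal_prod, Complex.ofReal_re]
  have ht : X.trace.re = ∑ i, hX.1.eigenvalues i := by
    rw [hX.1.trace_eq_sum_eigenvalues]
    simp
  rw [hd, ht, Real.log_prod (fun i _ => (hX.eigenvalues_pos i).ne')]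
  have : ∑ i, Real.log (hX.1.eigenvalues i) ≤ ∑ i, (hX.1.eigenvalues i - 1) :=
    Finset.sum_le_sum fun i _ => Real.log_le_sub_one_of_pos (hX.eigenvalues_pos i)
  simpa using this

lemma posDef_det_aux {n : ℕ} {X : Matrix (Fin n) (Fin n) ℂ} (hX : X.PosDef) :
    0 < X.det.re ∧ X.det.im = 0 := by
  have := Complex.pos_iff.mp hX.det_pos
  exact ⟨this.1, this.2.symm⟩

lemma gibbs_aux {n : ℕ} {P Q : Matrix (Fin n) (Fin n) ℂ} (hP : P.PosDef) (hQ : Q.PosDef) :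
    Real.log Q.det.re - Real.log P.det.re ≤ ((P⁻¹ * Q).trace).re - n := by
  obtain ⟨L, hL, h⟩ := exists_factor_aux hP.inv
  have hX : (L * Q * Lᴴ).PosDef :=
    hQ.mul_mul_conjTranspose_same (Matrix.vecMul_injective_of_isUnit hL)
  have h1 := log_det_le_aux hX
  have ht : (L * Q * Lᴴ).trace = (P⁻¹ * Q).trace := by
    rw [h, Matrix.trace_mul_cycle]
  have hPu : IsUnit P.det := (Matrix.isUnit_iff_isUnit_det _).mp hP.isUnit
  have hd : (L * Q * Lᴴ).det * P.det = Q.det := by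
    have h2 : (P⁻¹).det * P.det = 1 := by
      rw [← Matrix.det_mul, Matrix.nonsing_inv_mul _ hPu, Matrix.det_one]
    rw [h, Matrix.det_mul] at h2
    rw [Matrix.det_mul, Matrix.det_mul]
    linear_combination Q.det * h2
  have hdr : (L * Q * Lᴴ).det.re * P.det.re = Q.det.re := by
    rw [← hd, Complex.mul_re, (posDef_det_aux hP).2]; ring
  rw [← hdr, Real.log_mul (posDef_det_aux hX).1.ne' (posDef_det_aux hP).1.ne', ← ht]
  linarith

lemma sel_aux {p N : ℕ} {A : Matrix (Fin p) (Fin N) ℂ} {B : Matrix (Fin (N - p)) (Fin N) ℂ}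
    (hAB : IsComplementarySelectionPair A B) :
    ∃ e : Fin p ⊕ Fin (N - p) ≃ Fin N,
      A = (1 : Matrix (Fin N) (Fin N) ℂ).submatrix (e ∘ Sum.inl) id ∧
      B = (1 : Matrix (Fin N) (Fin N) ℂ).submatrix (e ∘ Sum.inr) id := by
  obtain ⟨f, g, hf, hg, hr, hA, hB⟩ := hAB
  have hne : ∀ i j, f i ≠ g j := by
    intro i j h
    have : g j ∈ (Set.range f)ᶜ := hr ▸ Set.mem_range_self j
    exact this ⟨i, h⟩
  have hbij : Function.Bijective (Sum.elim f g) := by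
    refine ⟨hf.sumElim hg hne, fun x => ?_⟩
    by_cases hx : x ∈ Set.range f
    · obtain ⟨i, rfl⟩ := hx; exact ⟨Sum.inl i, rfl⟩
    · have : x ∈ Set.range g := by rw [hr]; exact hx
      obtain ⟨i, rfl⟩ := this; exact ⟨Sum.inr i, rfl⟩
  refine ⟨Equiv.ofBijective _ hbij, ?_, ?_⟩
  · ext i j; simp [hA, Matrix.one_apply, eq_comm]
  · ext i j; simp [hB, Matrix.one_apply, eq_comm]

section main
variable {p N : ℕ} {A : Matrix (Fin p) (Fin N) ℂ} {B : Matrix (Fin (N - p)) (Fin N) ℂ}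

lemma sel_rel_aux (hAB : IsComplementarySelectionPair A B) :
    A * Aᴴ = 1 ∧ B * Bᴴ = 1 ∧ A * Bᴴ = 0 ∧ B * Aᴴ = 0 ∧ Aᴴ * A + Bᴴ * B = 1 := by
  obtain ⟨e, hA, hB⟩ := sel_aux hAB
  refine ⟨?_, ?_, ?_, ?_, ?_⟩
  · ext i j; simp [hA, Matrix.mul_apply, Matrix.one_apply, apply_ite]
  · ext i j; simp [hB, Matrix.mul_apply, Matrix.one_apply, apply_ite]
  · ext i j; simp [hA, hB, Matrix.mul_apply, Matrix.one_apply, apply_ite]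
  · ext i j; simp [hA, hB, Matrix.mul_apply, Matrix.one_apply, apply_ite]
  · have h : ∀ i j, (∑ k, (1 : Matrix (Fin N) (Fin N) ℂ) k i * (1 : Matrix (Fin N) (Fin N) ℂ) k j)
        = (1 : Matrix (Fin N) (Fin N) ℂ) i j := by
      intro i j; simp [Matrix.one_apply, eq_comm]
    ext i j
    rw [← h, ← e.sum_comp, Fintype.sum_sum_type]
    simp [hA, hB, Matrix.mul_apply, Matrix.one_apply, apply_ite, eq_comm]

lemma vecMul_inj_aux {m n : ℕ} {X : Matrix (Fin m) (Fin n) ℂ} {Y : Matrix (Fin n) (Fin m) ℂ}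
    (h : X * Y = 1) : Function.Injective X.vecMul := by
  intro x y hxy
  have : (x ᵥ* X) ᵥ* Y = (y ᵥ* X) ᵥ* Y := by
    have hxy' : x ᵥ* X = y ᵥ* X := hxy
    rw [hxy']
  simpa [Matrix.vecMul_vecMul, h] using this

lemma S_posDef_aux (hAB : IsComplementarySelectionPair A B) {M : Matrix (Fin N) (Fin N) ℂ}
    (hM : M.PosDef) : (A * M * Aᴴ).PosDef :=
  hM.mul_mul_conjTranspose_same (vecMul_inj_aux (sel_rel_aux hAB).1)

lemma det_aux (hAB : IsComplementarySelectionPair A B) {M : Matrix (Fin N) (Fin N) ℂ}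
    (hM : M.PosDef) : M.det = (A * M * Aᴴ).det * (Gmat M A B).det := by
  obtain ⟨e, hA, hB⟩ := sel_aux hAB
  have hS := S_posDef_aux hAB hM
  let _ := hS.isUnit.invertible
  have h : M.submatrix e e
      = Matrix.fromBlocks (A * M * Aᴴ) (A * M * Bᴴ) (B * M * Aᴴ) (B * M * Bᴴ) := by
    ext (i | i) (j | j) <;>
    simp [hA, hB, Matrix.mul_apply, Matrix.one_apply, apply_ite]
  rw [← Matrix.det_submatrix_equiv_self e, h, Matrix.det_fromBlocks₁₁, Matrix.invOf_eq_nonsing_inv]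
  rfl

def Kaux (M : Matrix (Fin N) (Fin N) ℂ) (A : Matrix (Fin p) (Fin N) ℂ)
    (B : Matrix (Fin (N - p)) (Fin N) ℂ) : Matrix (Fin (N - p)) (Fin N) ℂ :=
  B - B * M * Aᴴ * (A * M * Aᴴ)⁻¹ * A

lemma KM_aux (hAB : IsComplementarySelectionPair A B) {M : Matrix (Fin N) (Fin N) ℂ}
    (hM : M.PosDef) : Kaux M A B * M = Gmat M A B * B := by
  obtain ⟨h1, h2, h3, h4, h5⟩ := sel_rel_aux hAB
  have hS := S_posDef_aux hAB hM
  have hSi : (A * M * Aᴴ)⁻¹ * (A * M * Aᴴ) = 1 :=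
    Matrix.nonsing_inv_mul _ ((Matrix.isUnit_iff_isUnit_det _).mp hS.isUnit)
  have ha : Kaux M A B * M * Aᴴ = 0 := by
    have : Kaux M A B * M * Aᴴ
      = B * M * Aᴴ - B * M * Aᴴ * ((A * M * Aᴴ)⁻¹ * (A * M * Aᴴ)) := by
      simp only [Kaux, Matrix.sub_mul, Matrix.mul_assoc]
    rw [this, hSi, Matrix.mul_one, sub_self]
  have hb : Kaux M A B * M * Bᴴ = Gmat M A B := by
    simp only [Kaux, Gmat, Matrix.sub_mul, Matrix.mul_assoc]
  calc Kaux M A B * M = Kaux M A B * M * (Aᴴ * A + Bᴴ * B) := by rw [h5, Matrix.mul_one]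
    _ = Kaux M A B * M * Aᴴ * A + Kaux M A B * M * Bᴴ * B := by
      simp only [Matrix.mul_add, Matrix.mul_assoc]
    _ = _ := by rw [ha, hb, Matrix.zero_mul, zero_add]

lemma KB_aux (hAB : IsComplementarySelectionPair A B) {M : Matrix (Fin N) (Fin N) ℂ} :
    Kaux M A B * Bᴴ = 1 := by
  obtain ⟨h1, h2, h3, h4, h5⟩ := sel_rel_aux hAB
  simp only [Kaux, Matrix.sub_mul, Matrix.mul_assoc, h2, h3, Matrix.mul_zero, sub_zero]

lemma BK_aux (hAB : IsComplementarySelectionPair A B) {M : Matrix (Fin N) (Fin N) ℂ} :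
    B * (Kaux M A B)ᴴ = 1 := by
  have := congrArg Matrix.conjTranspose (KB_aux hAB (M := M))
  simpa using this

lemma G_posDef_aux (hAB : IsComplementarySelectionPair A B) {M : Matrix (Fin N) (Fin N) ℂ}
    (hM : M.PosDef) : (Gmat M A B).PosDef := by
  have h := hM.mul_mul_conjTranspose_same (vecMul_inj_aux (KB_aux hAB (M := M)))
  rwa [KM_aux hAB hM, Matrix.mul_assoc, BK_aux hAB, Matrix.mul_one] at h

lemma inv_aux_s12 (hAB : IsComplementarySelectionPair A B) {M : Matrix (Fin N) (Fin N) ℂ}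
    (hM : M.PosDef) : M⁻¹ = Aᴴ * (A * M * Aᴴ)⁻¹ * A
      + (Kaux M A B)ᴴ * (Gmat M A B)⁻¹ * Kaux M A B := by
  obtain ⟨h1, h2, h3, h4, h5⟩ := sel_rel_aux hAB
  have hS := S_posDef_aux hAB hM
  have hG := G_posDef_aux hAB hM
  have hGi : (Gmat M A B)⁻¹ * Gmat M A B = 1 :=
    Matrix.nonsing_inv_mul _ ((Matrix.isUnit_iff_isUnit_det _).mp hG.isUnit)
  have hSi : (A * M * Aᴴ)⁻¹ * (A * M * Aᴴ) = 1 :=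
    Matrix.nonsing_inv_mul _ ((Matrix.isUnit_iff_isUnit_det _).mp hS.isUnit)
  have hK : (Kaux M A B)ᴴ = Bᴴ - Aᴴ * ((A * M * Aᴴ)⁻¹ * (A * M * Bᴴ)) := by
    have e1 : ((A * M * Aᴴ)⁻¹)ᴴ = (A * M * Aᴴ)⁻¹ := hS.inv.1
    have e2 : Mᴴ = M := hM.1
    rw [Kaux, Matrix.conjTranspose_sub, Matrix.conjTranspose_mul, Matrix.conjTranspose_mul, e1,
      Matrix.conjTranspose_mul, Matrix.conjTranspose_mul, e2, Matrix.conjTranspose_conjTranspose,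
      ← Matrix.mul_assoc A]
  apply Matrix.inv_eq_left_inv
  rw [Matrix.add_mul, Matrix.mul_assoc _ (Kaux M A B) M, KM_aux hAB hM,
    Matrix.mul_assoc _ _ (Gmat M A B * B), ← Matrix.mul_assoc _ _ B, hGi, Matrix.one_mul, hK]
  calc _ = Aᴴ * ((A * M * Aᴴ)⁻¹ * (A * M * (1 - Bᴴ * B))) + Bᴴ * B := by
        simp only [Matrix.sub_mul, Matrix.mul_sub, Matrix.mul_assoc, Matrix.mul_one]; abel
    _ = Aᴴ * ((A * M * Aᴴ)⁻¹ * (A * M * Aᴴ)) * A + Bᴴ * B := by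
        rw [← h5, add_sub_cancel_right]; simp only [Matrix.mul_assoc]
    _ = 1 := by rw [hSi, Matrix.mul_one, h5]

lemma quad_aux {m n : ℕ} (X : Matrix (Fin m) (Fin n) ℂ) (W : Matrix (Fin m) (Fin m) ℂ)
    (v : Fin n → ℂ) :
    star v ⬝ᵥ ((Xᴴ * W * X) *ᵥ v) = star (X *ᵥ v) ⬝ᵥ (W *ᵥ (X *ᵥ v)) := by
  simp only [star_mulVec, dotProduct_mulVec, vecMul_vecMul]

lemma trace_aux (hAB : IsComplementarySelectionPair A B) {M M₁ : Matrix (Fin N) (Fin N) ℂ}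
    (hM : M.PosDef) (y : Fin p → ℂ) :
    (M⁻¹ * Cmat M₁ A B y).trace = star y ⬝ᵥ ((A * M * Aᴴ)⁻¹ *ᵥ y)
      + star (muVec M₁ A B y - muVec M A B y) ⬝ᵥ
          ((Gmat M A B)⁻¹ *ᵥ (muVec M₁ A B y - muVec M A B y))
      + ((Gmat M A B)⁻¹ * Gmat M₁ A B).trace := by
  obtain ⟨h1, h2, h3, h4, h5⟩ := sel_rel_aux hAB
  have hAv : A *ᵥ (Aᴴ *ᵥ y + Bᴴ *ᵥ muVec M₁ A B y) = y := by
    simp [Matrix.mulVec_add, h1, h3]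
  have hKv : Kaux M A B *ᵥ (Aᴴ *ᵥ y + Bᴴ *ᵥ muVec M₁ A B y)
      = muVec M₁ A B y - muVec M A B y := by
    rw [Kaux, Matrix.sub_mulVec, ← Matrix.mulVec_mulVec, hAv]
    simp [Matrix.mulVec_add, h2, h4]
    simp [muVec]
  have hW : B * M⁻¹ * Bᴴ = (Gmat M A B)⁻¹ := by
    rw [inv_aux_s12 hAB hM, Matrix.mul_add, Matrix.add_mul]
    have e1 : B * (Aᴴ * (A * M * Aᴴ)⁻¹ * A) * Bᴴ = 0 := by
      simp only [← Matrix.mul_assoc, h4, Matrix.zero_mul]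
    have e2 : B * ((Kaux M A B)ᴴ * (Gmat M A B)⁻¹ * Kaux M A B) * Bᴴ
        = (B * (Kaux M A B)ᴴ) * (Gmat M A B)⁻¹ * (Kaux M A B * Bᴴ) := by
      simp only [Matrix.mul_assoc]
    rw [e1, e2, BK_aux hAB, KB_aux hAB, Matrix.one_mul, Matrix.mul_one, zero_add]
  rw [Cmat, Matrix.mul_add, Matrix.trace_add]
  congr 1
  · rw [Matrix.mul_vecMulVec, Matrix.trace_vecMulVec, dotProduct_comm, inv_aux_s12 hAB hM,
      Matrix.add_mulVec, dotProduct_add, quad_aux, quad_aux, hAv, hKv]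
  · rw [← hW, Matrix.mul_assoc B, Matrix.mul_assoc B, Matrix.trace_mul_comm B]
    simp only [Matrix.mul_assoc]

lemma log_det_aux (hAB : IsComplementarySelectionPair A B) {M : Matrix (Fin N) (Fin N) ℂ}
    (hM : M.PosDef) : Real.log M.det.re
      = Real.log (A * M * Aᴴ).det.re + Real.log (Gmat M A B).det.re := by
  have hS := posDef_det_aux (S_posDef_aux hAB hM)
  have hG := posDef_det_aux (G_posDef_aux hAB hM)
  rw [det_aux hAB hM, Complex.mul_re, hS.2, zero_mul, sub_zero, Real.log_mul hS.1.ne' hG.1.ne']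
end main

/-- the minorization (Gibbs/Jensen) inequality.  For a selection matrix `A`
with complementary selection matrix `B = Ā`, `y ∈ ℂ^p`, and Hermitian positive definite
`M, M₁`, setting `C₁ = C(M₁, A, y)`:
`ln det(A M A†) + y†(A M A†)⁻¹ y − ln det(A M₁ A†) − y†(A M₁ A†)⁻¹ y
  ≤ ln det M + tr(M⁻¹ C₁) − ln det M₁ − tr(M₁⁻¹ C₁)`. -/
theorem stmt12 {p N : ℕ} (hp : 1 ≤ p) (hpN : p ≤ N)
    (A : Matrix (Fin p) (Fin N) ℂ) (B : Matrix (Fin (N - p)) (Fin N) ℂ)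
    (hAB : IsComplementarySelectionPair A B) (y : Fin p → ℂ)
    (M M₁ : Matrix (Fin N) (Fin N) ℂ) (hM : M.PosDef) (hM₁ : M₁.PosDef) :
    Real.log ((A * M * Aᴴ).det.re) + (star y ⬝ᵥ ((A * M * Aᴴ)⁻¹ *ᵥ y)).re
      - Real.log ((A * M₁ * Aᴴ).det.re) - (star y ⬝ᵥ ((A * M₁ * Aᴴ)⁻¹ *ᵥ y)).re
    ≤ Real.log (M.det.re) + ((M⁻¹ * Cmat M₁ A B y).trace).re
      - Real.log (M₁.det.re) - ((M₁⁻¹ * Cmat M₁ A B y).trace).re := by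
  have hG := G_posDef_aux hAB hM
  have hG₁ := G_posDef_aux hAB hM₁
  have hg := gibbs_aux hG hG₁
  have hq : 0 ≤ (star (muVec M₁ A B y - muVec M A B y) ⬝ᵥ
      ((Gmat M A B)⁻¹ *ᵥ (muVec M₁ A B y - muVec M A B y))).re :=
    (Complex.nonneg_iff.mp (hG.inv.posSemidef.dotProduct_mulVec_nonneg _)).1
  have h1 : ((Gmat M₁ A B)⁻¹ * Gmat M₁ A B).trace = ((N - p : ℕ) : ℂ) := by
    rw [Matrix.nonsing_inv_mul _ ((Matrix.isUnit_iff_isUnit_det _).mp hG₁.isUnit)]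
    simp
  rw [trace_aux hAB hM, trace_aux hAB hM₁, h1, log_det_aux hAB hM, log_det_aux hAB hM₁,
    sub_self, star_zero, zero_dotProduct]
  simp only [Complex.add_re, Complex.zero_re, Complex.natCast_re]
  linarith
end
end

section
/- In the missing-data model, let M′, M″ ∈ ℂ^{N×N} be Hermitian positive definite and set Σ(M′) = (1/K) ∑_{i=1}^K C(M′, A_i, y_i). If ln det M″ + tr((M″)^{−1} Σ(M′)) ≤ ln det M′ + tr((M′)^{−1} Σ(M′)) (i.e., M″ does not decrease the EM surrogate built at M′), then L_y(M″) ≥ L_y(M′). -/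
open Matrix
open scoped ComplexOrder

noncomputable section

/-- EM conditional sample covariance `Σ(M′) = (1/K) ∑_{i=1}^K C(M′, A_i, y_i)`. -/
def SigmaEM {N K : ℕ} (p : Fin K → ℕ) (A : ∀ i, Matrix (Fin (p i)) (Fin N) ℂ)
    (B : ∀ i, Matrix (Fin (N - p i)) (Fin N) ℂ) (y : ∀ i, Fin (p i) → ℂ)
    (M : Matrix (Fin N) (Fin N) ℂ) : Matrix (Fin N) (Fin N) ℂ :=
  ((K : ℂ)⁻¹) • ∑ i, Cmat M (A i) (B i) (y i)

open scoped MatrixOrder in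
lemma exists_fact {n : Type*} [Fintype n] [DecidableEq n] {P : Matrix n n ℂ} (hP : P.PosDef) :
    ∃ H : Matrix n n ℂ, P = Hᴴ * H := by
  obtain ⟨H, hH⟩ := CStarAlgebra.nonneg_iff_eq_star_mul_self.mp hP.posSemidef.nonneg
  exact ⟨H, hH⟩

lemma det_re_pos {n : Type*} [Fintype n] [DecidableEq n] {P : Matrix n n ℂ} (hP : P.PosDef) :
    0 < P.det.re ∧ P.det = (P.det.re : ℂ) := by
  have h := Complex.lt_def.mp hP.det_pos
  refine ⟨by simpa using h.1, Complex.ext (by simp) (by simpa using h.2.symm)⟩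

lemma log_det_le_trace {n : Type*} [Fintype n] [DecidableEq n] {Z : Matrix n n ℂ}
    (hZ : Z.PosDef) : Real.log Z.det.re ≤ Z.trace.re - Fintype.card n := by
  have h1 : Z.det.re = ∏ i, hZ.1.eigenvalues i := by
    rw [hZ.1.det_eq_prod_eigenvalues]
    rw [← RCLike.ofReal_prod]; exact Complex.ofReal_re _
  have h2 : Z.trace.re = ∑ i, hZ.1.eigenvalues i := by
    rw [hZ.1.trace_eq_sum_eigenvalues]
    rw [← RCLike.ofReal_sum]; exact Complex.ofReal_re _
  rw [h1, h2, Real.log_prod (fun i _ => (hZ.eigenvalues_pos i).ne')]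
  have : ((Fintype.card n : ℕ) : ℝ) = ∑ i : n, (1 : ℝ) := by simp
  rw [this, ← Finset.sum_sub_distrib]
  exact Finset.sum_le_sum fun i _ => Real.log_le_sub_one_of_pos (hZ.eigenvalues_pos i)

lemma logdet_ineq {n : Type*} [Fintype n] [DecidableEq n] {X Y : Matrix n n ℂ}
    (hX : X.PosDef) (hY : Y.PosDef) :
    Real.log Y.det.re + Fintype.card n ≤ Real.log X.det.re + (X⁻¹ * Y).trace.re := by
  obtain ⟨H, hH⟩ := exists_fact hX.inv
  have hXu : IsUnit X.det := (isUnit_iff_isUnit_det _).mp hX.isUnit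
  have hHu : IsUnit H := by
    have h := hX.inv.isUnit
    rw [hH, isUnit_iff_isUnit_det, det_mul] at h
    rw [isUnit_iff_isUnit_det]
    exact isUnit_of_mul_isUnit_right h
  have hZ : (H * Y * Hᴴ).PosDef := (Matrix.IsUnit.posDef_star_right_conjugate_iff hHu).mpr hY
  have h := log_det_le_trace hZ
  have ht : (H * Y * Hᴴ).trace = (X⁻¹ * Y).trace := by
    rw [Matrix.trace_mul_comm, ← Matrix.mul_assoc, ← hH]
  have hd : X.det * (H * Y * Hᴴ).det = Y.det := by
    have : (H * Y * Hᴴ).det = X⁻¹.det * Y.det := by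
      rw [hH]; simp only [det_mul]; ring
    rw [this, ← mul_assoc, ← det_mul, mul_nonsing_inv _ hXu, det_one, one_mul]
  obtain ⟨x0, x1⟩ := det_re_pos hX
  obtain ⟨y0, y1⟩ := det_re_pos hY
  obtain ⟨z0, z1⟩ := det_re_pos hZ
  have hr : X.det.re * (H * Y * Hᴴ).det.re = Y.det.re := by
    rw [x1, y1, z1] at hd
    exact_mod_cast hd
  rw [ht] at h
  rw [← hr, Real.log_mul x0.ne' z0.ne']
  linarith

lemma sel_props {p N : ℕ} {A : Matrix (Fin p) (Fin N) ℂ}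
    {B : Matrix (Fin (N - p)) (Fin N) ℂ} (h : IsComplementarySelectionPair A B) :
    A * Aᴴ = 1 ∧ B * Bᴴ = 1 ∧ A * Bᴴ = 0 ∧ B * Aᴴ = 0 ∧ Aᴴ * A + Bᴴ * B = 1 := by
  obtain ⟨f, g, hf, hg, hr, hA, hB⟩ := h
  have hfg : ∀ i j, f i ≠ g j := by
    intro i j e
    have : g j ∈ (Set.range f)ᶜ := hr ▸ Set.mem_range_self j
    exact this ⟨i, e⟩
  have hAB : A * Bᴴ = 0 := by
    ext i j
    simp [mul_apply, hA, hB, (hfg i j).symm]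
  refine ⟨?_, ?_, hAB, ?_, ?_⟩
  · ext i j
    simp [mul_apply, hA, one_apply, hf.eq_iff, eq_comm]
  · ext i j
    simp [mul_apply, hB, one_apply, hg.eq_iff, eq_comm]
  · simpa using congrArg conjTranspose hAB
  · ext i j
    simp only [Matrix.add_apply, mul_apply, conjTranspose_apply, hA, hB, one_apply]
    by_cases hi : i ∈ Set.range f
    · obtain ⟨a, rfl⟩ := hi
      simp [hfg, hf.eq_iff, eq_comm]
      rw [Finset.sum_eq_single a (fun b _ hb => by simp [hb.symm]) (by simp)]
      simp
    · have : i ∈ Set.range g := by rw [hr]; exact hi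
      obtain ⟨a, rfl⟩ := this
      have hfg' : ∀ i j, g j ≠ f i := fun i j e => hfg i j e.symm
      simp [hfg', hg.eq_iff, eq_comm]
      rw [Finset.sum_eq_single a (fun b _ hb => by simp [hb.symm]) (by simp)]
      simp

section core
variable {p N : ℕ} {A : Matrix (Fin p) (Fin N) ℂ} {B : Matrix (Fin (N - p)) (Fin N) ℂ}
  {M : Matrix (Fin N) (Fin N) ℂ}

lemma S_posDef (hA : A * Aᴴ = 1) (hM : M.PosDef) : (A * M * Aᴴ).PosDef := by
  refine hM.mul_mul_conjTranspose_same fun u v h => ?_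
  have := congrArg (fun w => w ᵥ* Aᴴ) h
  simpa [vecMul_vecMul, hA] using this

/-- the residual operator -/
def Tm (M : Matrix (Fin N) (Fin N) ℂ) (A : Matrix (Fin p) (Fin N) ℂ)
    (B : Matrix (Fin (N - p)) (Fin N) ℂ) : Matrix (Fin (N - p)) (Fin N) ℂ :=
  B - B * M * Aᴴ * (A * M * Aᴴ)⁻¹ * A

lemma Tm_H (hM : M.PosDef) :
    (Tm M A B)ᴴ = Bᴴ - Aᴴ * ((A * M * Aᴴ)⁻¹ * (A * M * Bᴴ)) := by
  simp [Tm, conjTranspose_sub, conjTranspose_mul, conjTranspose_nonsing_inv, hM.1.eq,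
    Matrix.mul_assoc]

lemma AMT (hA : A * Aᴴ = 1) (hM : M.PosDef) : A * M * (Tm M A B)ᴴ = 0 := by
  have hu : IsUnit (A * M * Aᴴ).det := (isUnit_iff_isUnit_det _).mp (S_posDef hA hM).isUnit
  rw [Tm_H hM, Matrix.mul_sub, ← Matrix.mul_assoc (A * M) Aᴴ, ← Matrix.mul_assoc (A * M * Aᴴ),
    mul_nonsing_inv _ hu, Matrix.one_mul, sub_self]

lemma BMT (hM : M.PosDef) : B * M * (Tm M A B)ᴴ = Gmat M A B := by
  rw [Tm_H hM, Gmat, Matrix.mul_sub]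
  simp only [Matrix.mul_assoc]

lemma G_eq (hA : A * Aᴴ = 1) (hM : M.PosDef) :
    Gmat M A B = Tm M A B * M * (Tm M A B)ᴴ := by
  have e : Tm M A B * M * (Tm M A B)ᴴ
      = (B - B * M * Aᴴ * (A * M * Aᴴ)⁻¹ * A) * M * (Tm M A B)ᴴ := rfl
  rw [e, Matrix.sub_mul, Matrix.sub_mul]
  rw [show B * M * Aᴴ * (A * M * Aᴴ)⁻¹ * A * M * (Tm M A B)ᴴ
    = B * M * Aᴴ * (A * M * Aᴴ)⁻¹ * (A * M * (Tm M A B)ᴴ) by simp only [Matrix.mul_assoc]]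
  rw [AMT hA hM, BMT hM, Matrix.mul_zero, sub_zero]

lemma TB (hB : B * Bᴴ = 1) (hAB : A * Bᴴ = 0) : Tm M A B * Bᴴ = 1 := by
  rw [Tm, Matrix.sub_mul, hB, Matrix.mul_assoc _ A, hAB, Matrix.mul_zero, sub_zero]

lemma G_posDef (hA : A * Aᴴ = 1) (hB : B * Bᴴ = 1) (hAB : A * Bᴴ = 0) (hM : M.PosDef) :
    (Gmat M A B).PosDef := by
  rw [G_eq hA hM]
  refine hM.mul_mul_conjTranspose_same fun u v h => ?_
  have := congrArg (fun w => w ᵥ* Bᴴ) h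
  simpa [vecMul_vecMul, TB hB hAB] using this

lemma inv_formula (hA : A * Aᴴ = 1) (hB : B * Bᴴ = 1) (hAB : A * Bᴴ = 0)
    (h1 : Aᴴ * A + Bᴴ * B = 1) (hM : M.PosDef) :
    M⁻¹ = Aᴴ * (A * M * Aᴴ)⁻¹ * A + (Tm M A B)ᴴ * (Gmat M A B)⁻¹ * Tm M A B := by
  have hu : IsUnit (A * M * Aᴴ).det := (isUnit_iff_isUnit_det _).mp (S_posDef hA hM).isUnit
  have hg : IsUnit (Gmat M A B).det :=
    (isUnit_iff_isUnit_det _).mp (G_posDef hA hB hAB hM).isUnit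
  apply inv_eq_right_inv
  set W := Aᴴ * (A * M * Aᴴ)⁻¹ * A + (Tm M A B)ᴴ * (Gmat M A B)⁻¹ * Tm M A B with hW
  have e1 : A * (M * W) = A := by
    rw [hW, ← Matrix.mul_assoc, Matrix.mul_add]
    rw [show A * M * (Aᴴ * (A * M * Aᴴ)⁻¹ * A) = (A * M * Aᴴ) * (A * M * Aᴴ)⁻¹ * A by
      simp only [Matrix.mul_assoc]]
    rw [show A * M * ((Tm M A B)ᴴ * (Gmat M A B)⁻¹ * Tm M A B)
      = (A * M * (Tm M A B)ᴴ) * ((Gmat M A B)⁻¹ * Tm M A B) by simp only [Matrix.mul_assoc]]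
    rw [mul_nonsing_inv _ hu, AMT hA hM, Matrix.one_mul, Matrix.zero_mul, add_zero]
  have e2 : B * (M * W) = B := by
    rw [hW, ← Matrix.mul_assoc, Matrix.mul_add]
    rw [show B * M * ((Tm M A B)ᴴ * (Gmat M A B)⁻¹ * Tm M A B)
      = (B * M * (Tm M A B)ᴴ) * (Gmat M A B)⁻¹ * Tm M A B by simp only [Matrix.mul_assoc]]
    rw [BMT hM, mul_nonsing_inv _ hg, Matrix.one_mul, Tm]
    simp only [Matrix.mul_assoc]
    abel
  calc M * W = (Aᴴ * A + Bᴴ * B) * (M * W) := by rw [h1, Matrix.one_mul]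
    _ = Aᴴ * (A * (M * W)) + Bᴴ * (B * (M * W)) := by
      rw [Matrix.add_mul, Matrix.mul_assoc, Matrix.mul_assoc]
    _ = 1 := by rw [e1, e2, h1]

lemma det_formula (hA : A * Aᴴ = 1) (hB : B * Bᴴ = 1) (hAB : A * Bᴴ = 0) (hBA : B * Aᴴ = 0)
    (h1 : Aᴴ * A + Bᴴ * B = 1) (hM : M.PosDef) :
    M.det = (A * M * Aᴴ).det * (Gmat M A B).det := by
  have hu : IsUnit (A * M * Aᴴ) := (S_posDef hA hM).isUnit
  have k1 : fromRows A B * fromCols Aᴴ Bᴴ = 1 := by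
    rw [fromRows_mul_fromCols, hA, hB, hAB, hBA, fromBlocks_one]
  have k2 : fromCols Aᴴ Bᴴ * fromRows A B = 1 := by
    rw [fromCols_mul_fromRows, h1]
  rw [← det_conj_of_mul_eq_one (N := M) k1 k2, fromRows_mul, fromRows_mul_fromCols]
  haveI := hu.invertible
  rw [det_fromBlocks₁₁, invOf_eq_nonsing_inv, Gmat]

lemma logdet_formula (hA : A * Aᴴ = 1) (hB : B * Bᴴ = 1) (hAB : A * Bᴴ = 0) (hBA : B * Aᴴ = 0)
    (h1 : Aᴴ * A + Bᴴ * B = 1) (hM : M.PosDef) :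
    Real.log M.det.re = Real.log (A * M * Aᴴ).det.re + Real.log (Gmat M A B).det.re := by
  obtain ⟨x0, x1⟩ := det_re_pos (S_posDef hA hM)
  obtain ⟨y0, y1⟩ := det_re_pos (G_posDef hA hB hAB hM)
  rw [det_formula hA hB hAB hBA h1 hM, ← Real.log_mul x0.ne' y0.ne', x1, y1,
    ← Complex.ofReal_mul, Complex.ofReal_re, Complex.ofReal_re, Complex.ofReal_re]

lemma quad_H {m n : Type*} [Fintype m] [Fintype n] (x : n → ℂ) (Q : Matrix m n ℂ)
    (P : Matrix m m ℂ) :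
    star x ⬝ᵥ ((Qᴴ * P * Q) *ᵥ x) = star (Q *ᵥ x) ⬝ᵥ (P *ᵥ (Q *ᵥ x)) := by
  rw [← mulVec_mulVec, ← mulVec_mulVec, dotProduct_mulVec, star_mulVec]

lemma trace_formula {M' : Matrix (Fin N) (Fin N) ℂ} (y : Fin p → ℂ)
    (hA : A * Aᴴ = 1) (hB : B * Bᴴ = 1) (hAB : A * Bᴴ = 0) (hBA : B * Aᴴ = 0)
    (h1 : Aᴴ * A + Bᴴ * B = 1) (hM : M.PosDef) :
    (M⁻¹ * Cmat M' A B y).trace = star y ⬝ᵥ ((A * M * Aᴴ)⁻¹ *ᵥ y)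
      + star (muVec M' A B y - muVec M A B y) ⬝ᵥ
          ((Gmat M A B)⁻¹ *ᵥ (muVec M' A B y - muVec M A B y))
      + ((Gmat M A B)⁻¹ * Gmat M' A B).trace := by
  have hx : A *ᵥ (Aᴴ *ᵥ y + Bᴴ *ᵥ muVec M' A B y) = y := by
    rw [mulVec_add, mulVec_mulVec, mulVec_mulVec, hA, hAB]; simp
  have hbx : B *ᵥ (Aᴴ *ᵥ y + Bᴴ *ᵥ muVec M' A B y) = muVec M' A B y := by
    rw [mulVec_add, mulVec_mulVec, mulVec_mulVec, hB, hBA]; simp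
  have htx : Tm M A B *ᵥ (Aᴴ *ᵥ y + Bᴴ *ᵥ muVec M' A B y)
      = muVec M' A B y - muVec M A B y := by
    rw [Tm, sub_mulVec, hbx, ← mulVec_mulVec, hx]; rfl
  have hBT : B * (Tm M A B)ᴴ = 1 := by
    simpa using congrArg conjTranspose (TB (M := M) hB hAB)
  rw [Cmat, Matrix.mul_add, trace_add, mul_vecMulVec, trace_vecMulVec, dotProduct_comm,
    inv_formula hA hB hAB h1 hM, add_mulVec, dotProduct_add, quad_H, quad_H, hx, htx]
  congr 1
  rw [← Matrix.mul_assoc, Matrix.trace_mul_comm, ← Matrix.mul_assoc, ← Matrix.mul_assoc]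
  congr 2
  rw [Matrix.mul_add, Matrix.add_mul]
  rw [show B * (Aᴴ * (A * M * Aᴴ)⁻¹ * A) * Bᴴ = B * Aᴴ * (A * M * Aᴴ)⁻¹ * (A * Bᴴ) by
    simp only [Matrix.mul_assoc]]
  rw [show B * ((Tm M A B)ᴴ * (Gmat M A B)⁻¹ * Tm M A B) * Bᴴ
    = B * (Tm M A B)ᴴ * (Gmat M A B)⁻¹ * (Tm M A B * Bᴴ) by simp only [Matrix.mul_assoc]]
  rw [hAB, hBT, TB hB hAB]; simp

lemma per_sample {M' M'' : Matrix (Fin N) (Fin N) ℂ} (y : Fin p → ℂ)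
    (h : IsComplementarySelectionPair A B) (hM' : M'.PosDef) (hM'' : M''.PosDef) :
    (Real.log (A * M'' * Aᴴ).det.re + (star y ⬝ᵥ ((A * M'' * Aᴴ)⁻¹ *ᵥ y)).re)
      - (Real.log (A * M' * Aᴴ).det.re + (star y ⬝ᵥ ((A * M' * Aᴴ)⁻¹ *ᵥ y)).re)
    ≤ (Real.log M''.det.re + (M''⁻¹ * Cmat M' A B y).trace.re)
      - (Real.log M'.det.re + (M'⁻¹ * Cmat M' A B y).trace.re) := by
  obtain ⟨hA, hB, hAB, hBA, h1⟩ := sel_props h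
  have g' := G_posDef hA hB hAB hM'
  have g'' := G_posDef hA hB hAB hM''
  have hg : IsUnit (Gmat M' A B).det := (isUnit_iff_isUnit_det _).mp g'.isUnit
  rw [trace_formula y hA hB hAB hBA h1 hM', trace_formula y hA hB hAB hBA h1 hM'',
    logdet_formula hA hB hAB hBA h1 hM', logdet_formula hA hB hAB hBA h1 hM'',
    nonsing_inv_mul _ hg, sub_self]
  have k1 := logdet_ineq g'' g'
  have k2 : 0 ≤ (star (muVec M' A B y - muVec M'' A B y) ⬝ᵥ
      ((Gmat M'' A B)⁻¹ *ᵥ (muVec M' A B y - muVec M'' A B y))).re :=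
    g''.inv.posSemidef.re_dotProduct_nonneg _
  simp only [Complex.add_re, trace_one, mulVec_zero, dotProduct_zero, Complex.zero_re,
    Complex.natCast_re]
  linarith

end core

/-- in the missing-data model, if `M″` does not decrease the EM surrogate built
at `M′`, i.e. `ln det M″ + tr((M″)⁻¹ Σ(M′)) ≤ ln det M′ + tr((M′)⁻¹ Σ(M′))`, then
`L_y(M″) ≥ L_y(M′)`. -/
theorem stmt13 {N K : ℕ} (hN : 0 < N) (hK : 0 < K)
    (p : Fin K → ℕ) (hp : ∀ i, 1 ≤ p i ∧ p i ≤ N)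
    (A : ∀ i, Matrix (Fin (p i)) (Fin N) ℂ)
    (B : ∀ i, Matrix (Fin (N - p i)) (Fin N) ℂ)
    (hAB : ∀ i, IsComplementarySelectionPair (A i) (B i))
    (y : ∀ i, Fin (p i) → ℂ)
    (M' M'' : Matrix (Fin N) (Fin N) ℂ) (hM' : M'.PosDef) (hM'' : M''.PosDef)
    (hsurr : Real.log (M''.det.re) + ((M''⁻¹ * SigmaEM p A B y M').trace).re
        ≤ Real.log (M'.det.re) + ((M'⁻¹ * SigmaEM p A B y M').trace).re) :
    obsLogLik p A y M' ≤ obsLogLik p A y M'' := by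
  have hK0 : (K : ℝ) ≠ 0 := by exact_mod_cast hK.ne'
  have tr : ∀ X : Matrix (Fin N) (Fin N) ℂ, (X * SigmaEM p A B y M').trace.re
      = (K : ℝ)⁻¹ * ∑ i, (X * Cmat M' (A i) (B i) (y i)).trace.re := by
    intro X
    rw [SigmaEM, Matrix.mul_smul, trace_smul, Matrix.mul_sum, trace_sum, smul_eq_mul,
      ← Complex.ofReal_natCast, ← Complex.ofReal_inv, Complex.re_ofReal_mul, Complex.re_sum]
  rw [tr, tr] at hsurr
  have hs := Finset.sum_le_sum fun i (_ : i ∈ Finset.univ) =>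
    per_sample (y i) (hAB i) hM' hM''
  have h2 := mul_le_mul_of_nonneg_left hsurr (Nat.cast_nonneg (α := ℝ) K)
  rw [mul_add, mul_add, mul_inv_cancel_left₀ hK0, mul_inv_cancel_left₀ hK0] at h2
  simp only [Finset.sum_sub_distrib, Finset.sum_add_distrib, Finset.sum_const, Finset.card_univ,
    Fintype.card_fin, nsmul_eq_mul] at hs
  simp only [obsLogLik, Finset.sum_add_distrib]
  linarith
end
end

section
/- Let F be a closed subset of ℝ^V, let q : ℝ^V × ℝ^V → ℝ be continuous, and let f : ℝ^V → ℝ be continuous, such that the minorization property f(θ) − f(θ₁) ≥ q(θ, θ₁) − q(θ₁, θ₁) holds for all θ, θ₁ ∈ F. Let (θ_h)_{h≥0} be a sequence in F such that, for every h, θ_{h+1} maximizes θ ↦ q(θ, θ_h) over F. Then f(θ_h) is nondecreasing, and if θ* ∈ F is a limit point of (θ_h) (i.e., the limit of some subsequence), then θ* maximizes θ ↦ q(θ, θ*) over F, i.e., q(θ, θ*) ≤ q(θ*, θ*) for all θ ∈ F. -/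
open Filter

noncomputable section

/-- the abstract minorization–maximization (MM/EM) limit-point property.
Let `F ⊆ ℝ^V` be closed, `q` continuous on `ℝ^V × ℝ^V`, `f` continuous, with the minorization
property `f(θ) − f(θ₁) ≥ q(θ, θ₁) − q(θ₁, θ₁)` on `F`.  If `(θ_h)` is a sequence in `F` such
that each `θ_{h+1}` maximizes `θ ↦ q(θ, θ_h)` over `F`, then `f(θ_h)` is nondecreasing and any
limit point `θ* ∈ F` of `(θ_h)` maximizes `θ ↦ q(θ, θ*)` over `F`. -/
theorem stmt16 {V : ℕ}
    (F : Set (Fin V → ℝ)) (hF : IsClosed F)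
    (q : (Fin V → ℝ) → (Fin V → ℝ) → ℝ)
    (hq : Continuous fun z : (Fin V → ℝ) × (Fin V → ℝ) => q z.1 z.2)
    (f : (Fin V → ℝ) → ℝ) (hf : Continuous f)
    (hminor : ∀ θ ∈ F, ∀ θ₁ ∈ F, q θ θ₁ - q θ₁ θ₁ ≤ f θ - f θ₁)
    (θseq : ℕ → (Fin V → ℝ)) (hmem : ∀ h, θseq h ∈ F)
    (hmax : ∀ h, ∀ θ ∈ F, q θ (θseq h) ≤ q (θseq (h + 1)) (θseq h)) :
    Monotone (fun h => f (θseq h)) ∧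
    ∀ θstar ∈ F,
      (∃ φ : ℕ → ℕ, StrictMono φ ∧ Tendsto (θseq ∘ φ) atTop (nhds θstar)) →
      ∀ θ ∈ F, q θ θstar ≤ q θstar θstar := by
  have hmono : Monotone (fun h => f (θseq h)) := by
    apply monotone_nat_of_le_succ
    intro h
    have h1 := hmax h _ (hmem h)
    have h2 := hminor _ (hmem (h + 1)) _ (hmem h)
    linarith
  refine ⟨hmono, ?_⟩
  rintro θstar - ⟨φ, hφ, hlim⟩ θ hθ
  have hflim : Tendsto (fun k => f (θseq (φ k))) atTop (nhds (f θstar)) :=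
    (hf.tendsto θstar).comp hlim
  have hle : ∀ n, f (θseq n) ≤ f θstar := by
    intro n
    refine ge_of_tendsto hflim ?_
    filter_upwards [eventually_ge_atTop n] with k hk
    exact hmono (hk.trans (hφ.id_le k))
  have hc1 : Continuous fun x => q θ x :=
    hq.comp (continuous_const.prodMk continuous_id)
  have hc2 : Continuous fun x => q x x :=
    hq.comp (continuous_id.prodMk continuous_id)
  have hc : Continuous fun x => q θ x - q x x + f x := (hc1.sub hc2).add hf
  have hl : Tendsto (fun k => q θ (θseq (φ k)) - q (θseq (φ k)) (θseq (φ k)) + f (θseq (φ k)))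
      atTop (nhds (q θ θstar - q θstar θstar + f θstar)) :=
    (hc.tendsto θstar).comp hlim
  have key : q θ θstar - q θstar θstar + f θstar ≤ f θstar := by
    refine le_of_tendsto' hl ?_
    intro k
    have h1 := hmax (φ k) θ hθ
    have h2 := hminor _ (hmem (φ k + 1)) _ (hmem (φ k))
    have h3 := hle (φ k + 1)
    linarith
  linarith
end
end
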